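/- arXiv:1007.4270 — 2 statements merged into one kernel-verified Lean document; each statement's English description precedes it below -/
import Mathlib

section
/- Let Π be an m-dimensional linear subspace of ℝⁿ with a fixed Lebesgue measure. The function assigning to each convex body contained in some translate a + Π its m-dimensional volume (with respect to the shifted measure) is a homogeneous polynomial of degree m with respect to Minkowski addition and nonnegative scaling: Vol(c₁Δ₁ + ⋯ + c_kΔ_k) is a homogeneous polynomial of degree m in c₁,…,c_k ≥ 0 for convex bodies Δ₁,…,Δ_k each parallel to Π and lying in a common translate of Π. -/
open Pointwise MeasureTheory

theorem exists_finset_interpolation {X : Type*} (V : Submodule ℝ (X → ℝ)) [FiniteDimensional ℝ V] :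
    ∃ (S : Finset X) (w : S → X → ℝ), (∀ s, w s ∈ V) ∧
      ∀ g ∈ V, ∀ x, g x = ∑ s : S, g s * w s x := by
  classical
  let ev : X → Submodule ℝ V := fun x => LinearMap.ker ((LinearMap.proj x).comp V.subtype)
  obtain ⟨S, hS⟩ := Finset.exists_inf_le ev
  let ρ : V →ₗ[ℝ] (S → ℝ) := (LinearMap.funLeft ℝ ℝ (fun s : S => (s : X))).comp V.subtype
  have hρ : LinearMap.ker ρ = ⊥ := by
    rw [LinearMap.ker_eq_bot']
    intro g hg
    ext x
    have hg' : g ∈ S.inf ev := by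
      rw [Submodule.mem_finsetInf]
      intro s hs
      exact congrFun hg ⟨s, hs⟩
    exact hS x hg'
  obtain ⟨L, hL⟩ := LinearMap.exists_leftInverse_of_injective ρ hρ
  refine ⟨S, fun s => L (Pi.single s 1), fun s => (L _).2, fun g hg x => ?_⟩
  have h1 : L (ρ ⟨g, hg⟩) = ⟨g, hg⟩ := LinearMap.congr_fun hL ⟨g, hg⟩
  rw [pi_eq_sum_univ' (ρ ⟨g, hg⟩), map_sum] at h1
  have h2 := congrFun (congrArg Subtype.val h1) x
  simp only [Submodule.coe_sum, Finset.sum_apply, map_smul, Submodule.coe_smul, Pi.smul_apply,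
    smul_eq_mul] at h2
  rw [← h2]
  rfl

theorem tendsto_mem_of_finiteDimensional {X : Type*} (V : Submodule ℝ (X → ℝ))
    [FiniteDimensional ℝ V] {F : ℕ → X → ℝ} {G : X → ℝ} (hF : ∀ j, F j ∈ V)
    (hlim : ∀ x, Filter.Tendsto (fun j => F j x) Filter.atTop (nhds (G x))) : G ∈ V :=
  V.closed_of_finiteDimensional.mem_of_tendsto (tendsto_pi_nhds.2 hlim) (.of_forall hF)

theorem integral_mem_of_finiteDimensional {X α : Type*} [MeasurableSpace α] {μ : Measure α}
    (V : Submodule ℝ (X → ℝ)) [FiniteDimensional ℝ V] {F : α → X → ℝ} (hF : ∀ a, F a ∈ V)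
    (hint : ∀ x, Integrable (fun a => F a x) μ) : (fun x => ∫ a, F a x ∂μ) ∈ V := by
  obtain ⟨S, w, hw, h⟩ := exists_finset_interpolation V
  have : (fun x => ∫ a, F a x ∂μ) = ∑ s : S, (∫ a, F a s ∂μ) • w s := by
    ext x
    have h1 := integral_finsetSum Finset.univ fun (s : S) _ => (hint s).mul_const (w s x)
    simp_rw [h _ (hF _) x]
    simpa [integral_mul_const] using h1
  rw [this]
  exact V.sum_mem fun s _ => V.smul_mem _ (hw s)

/-- Functions on the nonnegative orthant given by homogeneous polynomials of degree `m`. -/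
noncomputable def homogeneousFunctions (ι : Type*) (m : ℕ) :
    Submodule ℝ ({c : ι → ℝ // ∀ i, 0 ≤ c i} → ℝ) :=
  (MvPolynomial.homogeneousSubmodule ι ℝ m).map
    (LinearMap.pi fun c => (MvPolynomial.aeval (R := ℝ) c.1).toLinearMap)

theorem mem_homogeneousFunctions {ι : Type*} {m : ℕ} {F : {c : ι → ℝ // ∀ i, 0 ≤ c i} → ℝ} :
    F ∈ homogeneousFunctions ι m ↔ ∃ p : MvPolynomial ι ℝ, p.IsHomogeneous m ∧
      ∀ c, F c = MvPolynomial.eval c.1 p := by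
  simp only [homogeneousFunctions, Submodule.mem_map, MvPolynomial.mem_homogeneousSubmodule]
  refine exists_congr fun p => and_congr_right fun _ => ?_
  rw [funext_iff]
  refine forall_congr' fun c => ?_
  rw [eq_comm]
  rfl

instance finiteDimensional_homogeneousFunctions (ι : Type*) [Finite ι] (m : ℕ) :
    FiniteDimensional ℝ (homogeneousFunctions ι m) :=
  Module.Finite.iff_fg.2 ((MvPolynomial.homogeneousSubmodule_fg ι ℝ m).map _)

theorem det_sum_smul_mem_homogeneousFunctions {E ι : Type*} [Fintype ι] [AddCommGroup E]
    [Module ℝ E] [FiniteDimensional ℝ E] (A : ι → E →ₗ[ℝ] E) :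
    (fun c : {c : ι → ℝ // ∀ i, 0 ≤ c i} => LinearMap.det (∑ i, c.1 i • A i)) ∈
      homogeneousFunctions ι (Module.finrank ℝ E) := by
  classical
  let b := Module.finBasis ℝ E
  let M : Matrix (Fin (Module.finrank ℝ E)) (Fin (Module.finrank ℝ E)) (MvPolynomial ι ℝ) :=
    fun r s => ∑ i, MvPolynomial.C (LinearMap.toMatrix b b (A i) r s) * MvPolynomial.X i
  refine mem_homogeneousFunctions.2 ⟨M.det, ?_, fun c => ?_⟩
  · rw [Matrix.det_apply]
    refine MvPolynomial.IsHomogeneous.sum _ _ _ fun σ _ => ?_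
    have h : (∏ i, M (σ i) i).IsHomogeneous (∑ _i : Fin (Module.finrank ℝ E), 1) :=
      MvPolynomial.IsHomogeneous.prod _ _ _ fun i _ =>
        MvPolynomial.IsHomogeneous.sum _ _ _ fun j _ => MvPolynomial.isHomogeneous_C_mul_X _ _
    simp only [Finset.sum_const, Finset.card_univ, Fintype.card_fin, smul_eq_mul, mul_one] at h
    rcases Int.units_eq_one_or (Equiv.Perm.sign σ) with h1 | h1 <;> rw [h1]
    · simpa using h
    · simpa using h.neg
  · rw [← LinearMap.det_toMatrix b, RingHom.map_det]
    congr 1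
    ext r s
    change _ = MvPolynomial.eval c.1 (M r s)
    simp [M, LinearMap.toMatrix_apply, mul_comm]

section SoftMax
open scoped RealInnerProductSpace
variable {E : Type*} [NormedAddCommGroup E] [InnerProductSpace ℝ E]

/-- The partition function `∑ v ∈ V, exp ⟪v, x⟫` of a finite set `V`. -/
noncomputable def expSum (V : Finset E) (x : E) : ℝ := ∑ v ∈ V, Real.exp ⟪v, x⟫

/-- The softmax weights: the Gibbs measure on `V` with energy `-⟪·, x⟫`. -/
noncomputable def gibbs (V : Finset E) (x v : E) : ℝ := Real.exp ⟪v, x⟫ / expSum V x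

/-- The gradient of `x ↦ log (∑ v ∈ V, exp ⟪v, x⟫)`, the barycenter of the Gibbs measure. -/
noncomputable def gibbsMean (V : Finset E) (x : E) : E := ∑ v ∈ V, gibbs V x v • v

/-- The Hessian of `x ↦ log (∑ v ∈ V, exp ⟪v, x⟫)`, the covariance of the Gibbs measure. -/
noncomputable def gibbsCov (V : Finset E) (x : E) : E →L[ℝ] E :=
  ∑ v ∈ V, (gibbs V x v • innerSL ℝ (v - gibbsMean V x)).smulRight v

variable {V : Finset E}

theorem expSum_pos (hV : V.Nonempty) (x : E) : 0 < expSum V x :=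
  Finset.sum_pos (fun _ _ => Real.exp_pos _) hV

theorem gibbs_pos (hV : V.Nonempty) (x v : E) : 0 < gibbs V x v :=
  div_pos (Real.exp_pos _) (expSum_pos hV x)

theorem sum_gibbs (hV : V.Nonempty) (x : E) : ∑ v ∈ V, gibbs V x v = 1 := by
  simp only [gibbs]
  rw [← Finset.sum_div]
  exact div_self (expSum_pos hV x).ne'

theorem gibbsMean_mem_convexHull (hV : V.Nonempty) (x : E) :
    gibbsMean V x ∈ convexHull ℝ (V : Set E) :=
  (convex_convexHull ℝ _).sum_mem (fun v _ => (gibbs_pos hV x v).le) (sum_gibbs hV x)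
    fun _ hv => subset_convexHull ℝ _ hv

theorem hasFDerivAt_expSum (V : Finset E) (x : E) :
    HasFDerivAt (expSum V) (∑ v ∈ V, Real.exp ⟪v, x⟫ • innerSL ℝ v) x :=
  HasFDerivAt.fun_sum fun v _ => ((innerSL ℝ v).hasFDerivAt (x := x)).exp

theorem hasFDerivAt_log_expSum (hV : V.Nonempty) (x : E) :
    HasFDerivAt (fun x => Real.log (expSum V x)) (innerSL ℝ (gibbsMean V x)) x := by
  convert (hasFDerivAt_expSum V x).log (expSum_pos hV x).ne' using 1
  simp [gibbsMean, gibbs, Finset.smul_sum, map_sum, smul_smul, div_eq_inv_mul]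

theorem hasFDerivAt_gibbs (hV : V.Nonempty) (x v : E) :
    HasFDerivAt (fun x => gibbs V x v) (gibbs V x v • innerSL ℝ (v - gibbsMean V x)) x := by
  have h : (fun x => gibbs V x v) = fun x => Real.exp (innerSL ℝ v x - Real.log (expSum V x)) := by
    ext x
    rw [Real.exp_sub, Real.exp_log (expSum_pos hV x)]
    rfl
  have h' := (((innerSL ℝ v).hasFDerivAt (x := x)).sub (hasFDerivAt_log_expSum hV x)).exp
  rw [h, map_sub, show gibbs V x v = _ from congrFun h x]
  exact h'

theorem hasFDerivAt_gibbsMean (hV : V.Nonempty) (x : E) :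
    HasFDerivAt (gibbsMean V) (gibbsCov V x) x :=
  HasFDerivAt.fun_sum fun v _ => (hasFDerivAt_gibbs hV x v).smul_const v

theorem continuous_gibbs (hV : V.Nonempty) (v : E) : Continuous fun x => gibbs V x v :=
  continuous_iff_continuousAt.2 fun x => (hasFDerivAt_gibbs hV x v).continuousAt

theorem continuous_gibbsMean (hV : V.Nonempty) : Continuous (gibbsMean V) :=
  continuous_iff_continuousAt.2 fun x => (hasFDerivAt_gibbsMean hV x).continuousAt

theorem continuous_gibbsCov (hV : V.Nonempty) : Continuous (gibbsCov V) := by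
  refine continuous_finsetSum _ fun v _ => ?_
  have h : Continuous fun x => gibbs V x v • innerSL ℝ (v - gibbsMean V x) :=
    (continuous_gibbs hV v).smul
      ((innerSL ℝ).continuous.comp (continuous_const.sub (continuous_gibbsMean hV)))
  exact ((ContinuousLinearMap.smulRightL ℝ E E).flip v).continuous.comp h

theorem sum_gibbs_mul_inner (hV : V.Nonempty) (x h : E) :
    ∑ v ∈ V, gibbs V x v * ⟪v - gibbsMean V x, h⟫ = 0 := by
  simp_rw [inner_sub_left, mul_sub, Finset.sum_sub_distrib]
  rw [← Finset.sum_mul, sum_gibbs hV, gibbsMean, sum_inner]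
  simp [real_inner_smul_left]

theorem inner_gibbsCov (hV : V.Nonempty) (x h : E) :
    ⟪gibbsCov V x h, h⟫ = ∑ v ∈ V, gibbs V x v * ⟪v - gibbsMean V x, h⟫ ^ 2 := by
  have h0 : ∑ v ∈ V, gibbs V x v * ⟪v - gibbsMean V x, h⟫ * ⟪gibbsMean V x, h⟫ = 0 := by
    rw [← Finset.sum_mul, sum_gibbs_mul_inner hV, zero_mul]
  rw [← sub_zero (inner ℝ _ _), ← h0, gibbsCov, _root_.sum_apply, sum_inner,
    ← Finset.sum_sub_distrib]
  refine Finset.sum_congr rfl fun v _ => ?_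
  simp only [ContinuousLinearMap.smulRight_apply, _root_.smul_apply,
    innerSL_apply_apply, smul_eq_mul, real_inner_smul_left]
  rw [← mul_sub, ← inner_sub_left]
  ring

theorem inner_gibbsCov_nonneg (hV : V.Nonempty) (x h : E) : 0 ≤ ⟪gibbsCov V x h, h⟫ := by
  rw [inner_gibbsCov hV]
  exact Finset.sum_nonneg fun v _ => mul_nonneg (gibbs_pos hV x v).le (sq_nonneg _)

theorem inner_gibbsCov_pos (hV : V.Nonempty) (x : E) {h : E}
    (hh : ¬ ∃ t, ∀ v ∈ V, ⟪v, h⟫ = t) : 0 < ⟪gibbsCov V x h, h⟫ := by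
  push Not at hh
  obtain ⟨v, hv, hne⟩ := hh ⟪gibbsMean V x, h⟫
  rw [inner_gibbsCov hV]
  refine Finset.sum_pos' (fun v _ => mul_nonneg (gibbs_pos hV x v).le (sq_nonneg _))
    ⟨v, hv, mul_pos (gibbs_pos hV x v) ?_⟩
  rw [inner_sub_left]
  exact sq_pos_of_ne_zero (sub_ne_zero.2 hne)

theorem gibbsCov_eq_zero (hV : V.Nonempty) (x : E) {h : E}
    (hh : ∃ t, ∀ v ∈ V, ⟪v, h⟫ = t) : gibbsCov V x h = 0 := by
  obtain ⟨t, ht⟩ := hh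
  have hm : ⟪gibbsMean V x, h⟫ = t := by
    rw [gibbsMean, sum_inner, ← one_mul t, ← sum_gibbs hV x, Finset.sum_mul]
    exact Finset.sum_congr rfl fun v hv => by rw [real_inner_smul_left, ht v hv]
  rw [gibbsCov, _root_.sum_apply]
  refine Finset.sum_eq_zero fun v hv => ?_
  simp [ht v hv, hm]

theorem inner_le_log_expSum (x : E) {z : E} (hz : z ∈ convexHull ℝ (V : Set E)) :
    ⟪z, x⟫ ≤ Real.log (expSum V x) := by
  have hsub : convexHull ℝ (V : Set E) ⊆ {z | innerₗ E x z ≤ Real.log (expSum V x)} := by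
    refine convexHull_min (fun v hv => ?_) (convex_halfSpace_le (innerₗ E x).isLinear _)
    change ⟪x, v⟫ ≤ _
    rw [real_inner_comm, ← Real.log_exp ⟪v, x⟫]
    exact Real.log_le_log (Real.exp_pos _)
      (Finset.single_le_sum (f := fun v => Real.exp ⟪v, x⟫) (fun _ _ => (Real.exp_pos _).le) hv)
  rw [real_inner_comm]
  exact hsub hz

end SoftMax

theorem ContinuousLinearMap.det_nonneg_of_inner_nonneg {E : Type*} [NormedAddCommGroup E]
    [InnerProductSpace ℝ E] [FiniteDimensional ℝ E] {A : E →L[ℝ] E}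
    (hA : ∀ h, 0 ≤ inner ℝ (A h) h) : 0 ≤ A.det := by
  by_contra! hneg
  let B : ℝ → E →L[ℝ] E := fun t => (1 - t) • A + t • ContinuousLinearMap.id ℝ E
  have hB : Continuous fun t => (B t).det :=
    ContinuousLinearMap.continuous_det.comp (by fun_prop)
  have h0 : (B 0).det < 0 := by simpa [B] using hneg
  have h1 : (B 1).det = 1 := by simp [B, ContinuousLinearMap.det]
  obtain ⟨t, ⟨ht0, ht1⟩, ht⟩ := intermediate_value_Icc zero_le_one hB.continuousOn
    (show (0 : ℝ) ∈ Set.Icc _ _ from ⟨h0.le, by rw [h1]; exact zero_le_one⟩)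
  have htpos : 0 < t := ht0.lt_of_ne (by rintro rfl; exact h0.ne ht)
  obtain ⟨h, hker, hne⟩ := (Submodule.ne_bot_iff _).1
    (LinearMap.bot_lt_ker_of_det_eq_zero (f := (B t : E →ₗ[ℝ] E)) ht).ne'
  have hz : inner ℝ (B t h) h = 0 := by
    rw [show B t h = 0 from hker, inner_zero_left]
  have hexp : inner ℝ (B t h) h = (1 - t) * inner ℝ (A h) h + t * ‖h‖ ^ 2 := by
    simp [B, inner_add_left, real_inner_smul_left]
  have := mul_nonneg (sub_nonneg.2 ht1) (hA h)
  have := mul_pos htpos (pow_pos (norm_pos_iff.2 hne) 2)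
  linarith

theorem injective_of_inner_fderiv_pos {E : Type*} [NormedAddCommGroup E]
    [InnerProductSpace ℝ E] {F : E → E} {F' : E → E →L[ℝ] E}
    (hF : ∀ x, HasFDerivAt F (F' x) x) (hpos : ∀ x h, h ≠ 0 → 0 < inner ℝ (F' x h) h) :
    Function.Injective F := by
  intro x y hxy
  by_contra hne
  have hd : ∀ t : ℝ, HasDerivAt (fun t : ℝ => inner ℝ (F (x + t • (y - x))) (y - x))
      (inner ℝ (F' (x + t • (y - x)) (y - x)) (y - x)) t := by
    intro t
    have h1 : HasDerivAt (fun t : ℝ => x + t • (y - x)) (y - x) t := by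
      simpa using ((hasDerivAt_id t).smul_const (y - x)).const_add x
    have h2 := ((hF (x + t • (y - x))).comp_hasDerivAt t h1).inner ℝ
      (hasDerivAt_const t (y - x))
    simpa using h2
  have hmono := strictMono_of_hasDerivAt_pos hd fun t => hpos _ _ (sub_ne_zero.2 (Ne.symm hne))
  have := hmono zero_lt_one
  simp [hxy] at this

theorem Convex.measure_closure {E : Type*} [NormedAddCommGroup E] [NormedSpace ℝ E]
    [FiniteDimensional ℝ E] [MeasurableSpace E] [BorelSpace E] (μ : Measure E)
    [μ.IsAddHaarMeasure] {s : Set E} (hs : Convex ℝ s) : μ (closure s) = μ s := by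
  refine le_antisymm ?_ (measure_mono subset_closure)
  rw [closure_eq_self_union_frontier]
  refine (measure_union_le _ _).trans ?_
  rw [hs.addHaar_frontier μ, add_zero]

theorem Convex.measure_interior {E : Type*} [NormedAddCommGroup E] [NormedSpace ℝ E]
    [FiniteDimensional ℝ E] [MeasurableSpace E] [BorelSpace E] (μ : Measure E)
    [μ.IsAddHaarMeasure] {s : Set E} (hs : Convex ℝ s) : μ (interior s) = μ s := by
  refine le_antisymm (measure_mono interior_subset) ?_
  rw [← hs.measure_closure μ, closure_eq_interior_union_frontier]
  refine (measure_union_le _ _).trans ?_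
  rw [hs.addHaar_frontier μ, add_zero]

section MinkowskiSum
open scoped RealInnerProductSpace
variable {E : Type*} [NormedAddCommGroup E] [InnerProductSpace ℝ E] {ι : Type*} [Fintype ι]

theorem Convex.sum_smul {K : ι → Set E} (hK : ∀ i, Convex ℝ (K i)) (c : ι → ℝ) :
    Convex ℝ (∑ i, c i • K i) := by
  refine Finset.sum_induction _ (Convex ℝ) (fun _ _ => Convex.add) (convex_singleton 0) ?_
  exact fun i _ => (hK i).smul _

theorem IsCompact.sum_smul {K : ι → Set E} (hK : ∀ i, IsCompact (K i)) (c : ι → ℝ) :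
    IsCompact (∑ i, c i • K i) := by
  refine Finset.sum_induction _ IsCompact (fun _ _ => IsCompact.add) isCompact_singleton ?_
  exact fun i _ => (hK i).smul _

theorem mem_sum_smul_iff {K : ι → Set E} {c : ι → ℝ} {z : E} :
    z ∈ ∑ i, c i • K i ↔ ∃ w : ι → E, (∀ i, w i ∈ K i) ∧ ∑ i, c i • w i = z := by
  classical
  rw [Set.mem_fintype_sum]
  constructor
  · rintro ⟨g, hg, rfl⟩
    choose w hw hwg using hg
    exact ⟨w, hw, Finset.sum_congr rfl fun i _ => hwg i⟩
  · rintro ⟨w, hw, rfl⟩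
    exact ⟨fun i => c i • w i, fun i => Set.smul_mem_smul_set (hw i), rfl⟩

variable {V : ι → Finset E} {c : ι → ℝ}

theorem inner_le_sum_log_expSum (hc : ∀ i, 0 ≤ c i) {z : E}
    (hz : z ∈ ∑ i, c i • convexHull ℝ (V i : Set E)) (x : E) :
    ⟪z, x⟫ ≤ ∑ i, c i * Real.log (expSum (V i) x) := by
  obtain ⟨w, hw, rfl⟩ := mem_sum_smul_iff.1 hz
  rw [sum_inner]
  refine Finset.sum_le_sum fun i _ => ?_
  rw [real_inner_smul_left]
  exact mul_le_mul_of_nonneg_left (inner_le_log_expSum x (hw i)) (hc i)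

theorem hasFDerivAt_sum_gibbsMean (hV : ∀ i, (V i).Nonempty) (c : ι → ℝ) (x : E) :
    HasFDerivAt (fun x => ∑ i, c i • gibbsMean (V i) x) (∑ i, c i • gibbsCov (V i) x) x :=
  HasFDerivAt.fun_sum fun i _ => (hasFDerivAt_gibbsMean (hV i) x).const_smul (c i)

theorem interior_subset_range_sum_gibbsMean [FiniteDimensional ℝ E]
    (hV : ∀ i, (V i).Nonempty) (hc : ∀ i, 0 ≤ c i) :
    interior (∑ i, c i • convexHull ℝ (V i : Set E)) ⊆
      Set.range fun x => ∑ i, c i • gibbsMean (V i) x := by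
  intro y hy
  obtain ⟨r, hr, hball⟩ := Metric.nhds_basis_closedBall.mem_iff.1 (mem_interior_iff_mem_nhds.1 hy)
  let g : E → ℝ := fun x => ∑ i, c i * Real.log (expSum (V i) x) - innerSL ℝ y x
  have hg : ∀ x, HasFDerivAt g (∑ i, c i • innerSL ℝ (gibbsMean (V i) x) - innerSL ℝ y) x :=
    fun x => (HasFDerivAt.fun_sum fun i _ =>
      (hasFDerivAt_log_expSum (hV i) x).const_mul (c i)).sub (innerSL ℝ y).hasFDerivAt
  have hbound : ∀ x, r * ‖x‖ ≤ g x := by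
    intro x
    rcases eq_or_ne x 0 with rfl | hx
    · have := inner_le_sum_log_expSum hc (interior_subset hy) 0
      simpa [g] using this
    have hx' : ‖x‖ ≠ 0 := norm_ne_zero_iff.2 hx
    have hz : y + (r / ‖x‖) • x ∈ Metric.closedBall y r := by
      simp [norm_smul, abs_of_pos hr, hx']
    have := inner_le_sum_log_expSum hc (hball hz) x
    rw [inner_add_left, real_inner_smul_left, real_inner_self_eq_norm_sq] at this
    have he : r / ‖x‖ * ‖x‖ ^ 2 = r * ‖x‖ := by field_simp
    rw [he] at this
    change _ ≤ _ - ⟪y, x⟫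
    linarith
  have hlim : Filter.Tendsto g (Filter.cocompact E) Filter.atTop :=
    Filter.tendsto_atTop_mono hbound (tendsto_norm_cocompact_atTop.const_mul_atTop hr)
  have hcont : Continuous g := continuous_iff_continuousAt.2 fun x => (hg x).continuousAt
  obtain ⟨x, hx⟩ := hcont.exists_forall_le hlim
  have h0 := IsLocalMin.hasFDerivAt_eq_zero (Filter.Eventually.of_forall hx) (hg x)
  refine ⟨x, ?_⟩
  have h1 : innerSL ℝ (∑ i, c i • gibbsMean (V i) x) = innerSL ℝ y := by
    rw [map_sum, ← sub_eq_zero]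
    simpa only [map_smul] using h0
  refine ext_inner_right ℝ fun v => ?_
  exact DFunLike.congr_fun h1 v

theorem range_sum_gibbsMean_subset (hV : ∀ i, (V i).Nonempty) (c : ι → ℝ) :
    (Set.range fun x => ∑ i, c i • gibbsMean (V i) x) ⊆
      ∑ i, c i • convexHull ℝ (V i : Set E) := by
  rintro _ ⟨x, rfl⟩
  exact mem_sum_smul_iff.2 ⟨_, fun i => gibbsMean_mem_convexHull (hV i) x, rfl⟩

theorem inner_sum_gibbsCov (V : ι → Finset E) (c : ι → ℝ) (x h : E) :
    ⟪(∑ i, c i • gibbsCov (V i) x) h, h⟫ = ∑ i, c i * ⟪gibbsCov (V i) x h, h⟫ := by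
  simp [sum_inner, real_inner_smul_left]

theorem det_sum_gibbsCov_nonneg [FiniteDimensional ℝ E] (hV : ∀ i, (V i).Nonempty)
    (hc : ∀ i, 0 ≤ c i) (x : E) : 0 ≤ (∑ i, c i • gibbsCov (V i) x).det := by
  refine ContinuousLinearMap.det_nonneg_of_inner_nonneg fun h => ?_
  rw [inner_sum_gibbsCov]
  exact Finset.sum_nonneg fun i _ => mul_nonneg (hc i) (inner_gibbsCov_nonneg (hV i) x h)

variable [FiniteDimensional ℝ E] [MeasurableSpace E] [BorelSpace E]
  (μ : Measure E) [μ.IsAddHaarMeasure]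

theorem measure_setOf_inner_eq {h : E} (hh : h ≠ 0) (t : ℝ) : μ {z | ⟪z, h⟫ = t} = 0 := by
  rcases Set.eq_empty_or_nonempty {z : E | ⟪z, h⟫ = t} with he | ⟨y, hy⟩
  · rw [he, measure_empty]
  have hker : LinearMap.ker (innerₗ E h) ≠ ⊤ := by
    intro htop
    have : h ∈ LinearMap.ker (innerₗ E h) := htop ▸ Submodule.mem_top
    exact hh (inner_self_eq_zero.1 (show ⟪h, h⟫ = 0 from this))
  have hset : {z : E | ⟪z, h⟫ = t} = (fun z => z + -y) ⁻¹' (LinearMap.ker (innerₗ E h) : Set E) := by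
    ext z
    have hy : ⟪y, h⟫ = t := hy
    simp [inner_sub_right, ← sub_eq_add_neg, sub_eq_zero, real_inner_comm z h,
      real_inner_comm y h, hy]
  rw [hset, measure_preimage_add_right]
  exact Measure.addHaar_submodule μ _ hker

/-- The volume of a Minkowski combination of polytopes is the integral of the Jacobian of the
corresponding combination of Gibbs means, which maps the space onto its interior. -/
theorem measure_sum_smul_convexHull (hV : ∀ i, (V i).Nonempty) (hc : ∀ i, 0 ≤ c i) :
    μ (∑ i, c i • convexHull ℝ (V i : Set E)) =
      ∫⁻ x, ENNReal.ofReal (∑ i, c i • gibbsCov (V i) x).det ∂μ := by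
  by_cases hdeg : ∃ h : E, h ≠ 0 ∧ ∀ i, c i ≠ 0 → ∃ t, ∀ v ∈ V i, ⟪v, h⟫ = t
  · obtain ⟨h, hh, hflat⟩ := hdeg
    have hdet : ∀ x, (∑ i, c i • gibbsCov (V i) x).det = 0 := by
      intro x
      by_contra hne
      refine hh (LinearMap.ker_eq_bot'.1 (not_not.1 fun hk =>
        hne (LinearMap.det_eq_zero_iff_ker_ne_bot.2 hk)) h ?_)
      simp only [ContinuousLinearMap.coe_coe, _root_.sum_apply, _root_.smul_apply]
      refine Finset.sum_eq_zero fun i _ => ?_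
      by_cases hi : c i = 0
      · rw [hi, zero_smul]
      · rw [gibbsCov_eq_zero (hV i) x (hflat i hi), smul_zero]
    simp only [hdet, ENNReal.ofReal_zero, lintegral_zero]
    have hflat' : ∀ i, ∃ t, ∀ w ∈ convexHull ℝ (V i : Set E), c i * ⟪w, h⟫ = t := by
      intro i
      by_cases hi : c i = 0
      · exact ⟨0, fun w _ => by rw [hi, zero_mul]⟩
      obtain ⟨t, ht⟩ := hflat i hi
      refine ⟨c i * t, fun w hw => ?_⟩
      have hsub : convexHull ℝ (V i : Set E) ⊆ {w | innerₗ E h w = t} :=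
        convexHull_min (fun v hv => (real_inner_comm _ _).trans (ht v hv))
          (convex_hyperplane (innerₗ E h).isLinear t)
      rw [real_inner_comm, show ⟪h, w⟫ = t from hsub hw]
    choose t ht using hflat'
    refine measure_mono_null (fun z hz => ?_) (measure_setOf_inner_eq μ hh (∑ i, t i))
    obtain ⟨w, hw, rfl⟩ := mem_sum_smul_iff.1 hz
    simp only [Set.mem_ofPred_eq, sum_inner, real_inner_smul_left]
    exact Finset.sum_congr rfl fun i _ => ht i _ (hw i)
  · push Not at hdeg
    have hinj : Function.Injective fun x => ∑ i, c i • gibbsMean (V i) x := by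
      refine injective_of_inner_fderiv_pos (hasFDerivAt_sum_gibbsMean hV c) fun x h hh => ?_
      obtain ⟨i, hi, hvar⟩ := hdeg h hh
      rw [inner_sum_gibbsCov]
      refine Finset.sum_pos' (fun j _ => mul_nonneg (hc j) (inner_gibbsCov_nonneg (hV j) x h))
        ⟨i, Finset.mem_univ i, mul_pos ((hc i).lt_of_ne' hi) (inner_gibbsCov_pos (hV i) x ?_)⟩
      push Not
      exact hvar
    have hcov := lintegral_abs_det_fderiv_eq_addHaar_image μ MeasurableSet.univ
      (fun x _ => (hasFDerivAt_sum_gibbsMean hV c x).hasFDerivWithinAt) hinj.injOn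
    rw [Set.image_univ, setLIntegral_univ] at hcov
    simp_rw [abs_of_nonneg (det_sum_gibbsCov_nonneg hV hc _)] at hcov
    rw [hcov]
    refine le_antisymm ?_ (measure_mono (range_sum_gibbsMean_subset hV c))
    rw [← (Convex.sum_smul (fun i => convex_convexHull ℝ (V i : Set E)) c).measure_interior μ]
    exact measure_mono (interior_subset_range_sum_gibbsMean hV hc)

theorem measure_sum_smul_convexHull_mem (hV : ∀ i, (V i).Nonempty) :
    (fun c : {c : ι → ℝ // ∀ i, 0 ≤ c i} =>
      (μ (∑ i, c.1 i • convexHull ℝ (V i : Set E))).toReal) ∈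
      homogeneousFunctions ι (Module.finrank ℝ E) := by
  have hcont : ∀ c : ι → ℝ, Continuous fun x => (∑ i, c i • gibbsCov (V i) x).det := fun c =>
    ContinuousLinearMap.continuous_det.comp
      (continuous_finsetSum _ fun i _ => (continuous_gibbsCov (hV i)).const_smul (c i))
  have hfin : ∀ c : ι → ℝ, μ (∑ i, c i • convexHull ℝ (V i : Set E)) < ⊤ := fun c =>
    (IsCompact.sum_smul (fun i => (V i).finite_toSet.isCompact_convexHull (𝕜 := ℝ)) c).measure_lt_top
  have hint : ∀ c : {c : ι → ℝ // ∀ i, 0 ≤ c i},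
      Integrable (fun x => (∑ i, c.1 i • gibbsCov (V i) x).det) μ := by
    refine fun c => ⟨(hcont c.1).aestronglyMeasurable, ?_⟩
    rw [hasFiniteIntegral_iff_ofReal (.of_forall (det_sum_gibbsCov_nonneg hV c.2)),
      ← measure_sum_smul_convexHull μ hV c.2]
    exact hfin c.1
  have hmem := integral_mem_of_finiteDimensional (μ := μ)
    (homogeneousFunctions ι (Module.finrank ℝ E))
    (F := fun x c => (∑ i, c.1 i • gibbsCov (V i) x).det) (fun x => ?_) hint
  · convert hmem using 2 with c
    rw [measure_sum_smul_convexHull μ hV c.2,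
      integral_eq_lintegral_of_nonneg_ae (.of_forall (det_sum_gibbsCov_nonneg hV c.2))
        (hcont c.1).aestronglyMeasurable]
  · convert det_sum_smul_mem_homogeneousFunctions
      (fun i => (gibbsCov (V i) x : E →ₗ[ℝ] E)) using 2 with c
    rw [ContinuousLinearMap.det]
    congr 1
    ext h
    simp

theorem tendsto_measure_sum_smul_convexHull {K : ι → Set E} (hcvx : ∀ i, Convex ℝ (K i))
    {u : ι → ℕ → E} (hu : ∀ i j, u i j ∈ K i) (hdense : ∀ i, K i ⊆ closure (Set.range (u i)))
    (c : ι → ℝ) [DecidableEq E] :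
    Filter.Tendsto
      (fun j => μ (∑ i, c i • convexHull ℝ (((Finset.range (j + 1)).image (u i) : Finset E) : Set E)))
      Filter.atTop (nhds (μ (∑ i, c i • K i))) := by
  set S : ℕ → Set E := fun j =>
    ∑ i, c i • convexHull ℝ (((Finset.range (j + 1)).image (u i) : Finset E) : Set E) with hS
  have hmono : Monotone S := by
    intro j l hjl z hz
    obtain ⟨w, hw, rfl⟩ := mem_sum_smul_iff.1 hz
    refine mem_sum_smul_iff.2 ⟨w, fun i => convexHull_mono ?_ (hw i), rfl⟩
    exact Finset.coe_subset.2 (Finset.image_subset_image (Finset.range_mono (by lia)))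
  have hconv : Convex ℝ (⋃ j, S j) :=
    hmono.directed_le.convex_iUnion fun j => Convex.sum_smul (fun i => convex_convexHull ℝ _) c
  have hsub : ⋃ j, S j ⊆ ∑ i, c i • K i := by
    refine Set.iUnion_subset fun j z hz => ?_
    obtain ⟨w, hw, rfl⟩ := mem_sum_smul_iff.1 hz
    refine mem_sum_smul_iff.2 ⟨w, fun i => convexHull_min ?_ (hcvx i) (hw i), rfl⟩
    intro v hv
    obtain ⟨l, -, rfl⟩ := Finset.mem_image.1 (Finset.mem_coe.1 hv)
    exact hu i l
  have hsup : ∑ i, c i • K i ⊆ closure (⋃ j, S j) := by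
    intro z hz
    obtain ⟨w, hw, rfl⟩ := mem_sum_smul_iff.1 hz
    have hw' : w ∈ closure (Set.univ.pi fun i => Set.range (u i)) := by
      rw [closure_pi_set]
      exact fun i _ => hdense i (hw i)
    have hφ : Continuous fun w : ι → E => ∑ i, c i • w i := by fun_prop
    refine map_mem_closure (f := fun w : ι → E => ∑ i, c i • w i) hφ hw' fun w hw => ?_
    choose l hl using fun i => hw i trivial
    refine Set.mem_iUnion.2 ⟨Finset.univ.sup l, mem_sum_smul_iff.2 ⟨w, fun i => ?_, rfl⟩⟩
    refine subset_convexHull ℝ _ (Finset.mem_coe.2 (Finset.mem_image.2 ⟨l i, ?_, hl i⟩))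
    exact Finset.mem_range.2 (Nat.lt_succ_of_le (Finset.le_sup (Finset.mem_univ i)))
  have heq : μ (∑ i, c i • K i) = μ (⋃ j, S j) :=
    le_antisymm ((measure_mono hsup).trans (hconv.measure_closure μ).le) (measure_mono hsub)
  rw [heq]
  exact tendsto_measure_iUnion_atTop hmono

theorem measure_sum_smul_mem_homogeneousFunctions {K : ι → Set E}
    (hne : ∀ i, (K i).Nonempty) (hcpt : ∀ i, IsCompact (K i)) (hcvx : ∀ i, Convex ℝ (K i)) :
    (fun c : {c : ι → ℝ // ∀ i, 0 ≤ c i} => (μ (∑ i, c.1 i • K i)).toReal) ∈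
      homogeneousFunctions ι (Module.finrank ℝ E) := by
  classical
  have hseq : ∀ i, ∃ u : ℕ → E, (∀ j, u j ∈ K i) ∧ K i ⊆ closure (Set.range u) := by
    intro i
    have := (hne i).to_subtype
    refine ⟨fun j => TopologicalSpace.denseSeq (K i) j, fun j => Subtype.prop _, fun x hx => ?_⟩
    have h := TopologicalSpace.denseRange_denseSeq (K i) ⟨x, hx⟩
    refine map_mem_closure continuous_subtype_val h ?_
    rintro _ ⟨j, rfl⟩
    exact ⟨j, rfl⟩
  choose u hu hdense using hseq
  refine tendsto_mem_of_finiteDimensional _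
    (fun j => measure_sum_smul_convexHull_mem μ
      (V := fun i => (Finset.range (j + 1)).image (u i)) fun i => by simp) fun c => ?_
  exact (ENNReal.tendsto_toReal (IsCompact.sum_smul hcpt c.1).measure_lt_top.ne).comp
    (tendsto_measure_sum_smul_convexHull μ hcvx hu hdense c.1)

end MinkowskiSum

/-- let `Π` be an `m`-dimensional subspace of `ℝⁿ` with a fixed Lebesgue (Haar)
measure.  For convex bodies `Δᵢ = aᵢ + Kᵢ` parallel to `Π` (with `Kᵢ ⊆ Π` nonempty compact
convex), the volume `Vol(c₁Δ₁ + ⋯ + c_kΔ_k)` — computed in the translate of `Π` containing the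
sum, with the shifted measure, i.e. `μ (Σᵢ cᵢ • Kᵢ)` — is a homogeneous polynomial of degree
`m` in `c₁, …, c_k ≥ 0`. -/
theorem volume_homogeneous_polynomial_parallel_bodies
    (n m k : ℕ) (P : Submodule ℝ (EuclideanSpace ℝ (Fin n)))
    (hP : Module.finrank ℝ P = m)
    (μ : Measure P) [μ.IsAddHaarMeasure]
    (a : Fin k → EuclideanSpace ℝ (Fin n))
    (K : Fin k → Set P)
    (hne : ∀ i, (K i).Nonempty) (hcpt : ∀ i, IsCompact (K i)) (hcvx : ∀ i, Convex ℝ (K i)) :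
    ∃ p : MvPolynomial (Fin k) ℝ, p.IsHomogeneous m ∧
      ∀ c : Fin k → ℝ, (∀ i, 0 ≤ c i) →
        (μ (∑ i, c i • K i)).toReal = MvPolynomial.eval c p := by
  obtain ⟨p, hp, h⟩ := mem_homogeneousFunctions.1
    (measure_sum_smul_mem_homogeneousFunctions μ hne hcpt hcvx)
  exact ⟨p, hP ▸ hp, fun c hc => h ⟨c, hc⟩⟩
end

section
/- For G = GL(n, ℂ) acting on ℂⁿ \ {0}, and finite subsets A₁, …, A_n ⊆ ℤ_{≥0}, let L_{A_i} be the space of polynomials on ℂⁿ whose homogeneous components have degrees in A_i. The number of solutions in ℂⁿ \ {0} of a generic system f₁ = ⋯ = f_n = 0 with f_i ∈ L_{A_i} equals n! times the mixed integral Iφ(I₁, …, I_n), where φ(k) = k^{n-1}/(n-1)! and I_i = [min A_i, max A_i] is the convex hull of A_i in ℝ. -/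
open MvPolynomial

/-- The space `L_A` of polynomials on `ℂⁿ` whose homogeneous components have degrees in the
finite set `A`. -/
noncomputable def degSpace (n : ℕ) (A : Finset ℕ) : Submodule ℂ (MvPolynomial (Fin n) ℂ) :=
  ⨆ k ∈ A, MvPolynomial.homogeneousSubmodule (Fin n) ℂ k

/-- A subset `U` of a (finite dimensional) complex vector space is generic (Zariski open and
dense) if its complement lies in the zero set of a nonzero polynomial. -/
def IsGenericSubset {V : Type*} [AddCommGroup V] [Module ℂ V] (U : Set V) : Prop :=
  ∃ (N : ℕ) (e : V ≃ₗ[ℂ] (Fin N → ℂ)) (q : MvPolynomial (Fin N) ℂ), q ≠ 0 ∧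
    ∀ v : V, v ∉ U → MvPolynomial.eval (e v) q = 0

/-- The mixed integral `Iφ(I₁, …, I_n)` of `φ(t) = t^{n-1}/(n-1)!` over intervals
`I_i = [a_i, b_i]`, given by the polarization formula applied to
`I ↦ ∫_I φ = (b^n - a^n)/n!`. -/
noncomputable def mixedIntegralPhi (n : ℕ) (a b : Fin n → ℝ) : ℝ :=
  (1 / n.factorial) * ∑ S : Finset (Fin n),
    (-1 : ℝ) ^ (n - S.card) * (((∑ i ∈ S, b i) ^ n - (∑ i ∈ S, a i) ^ n) / n.factorial)

theorem exists_relation_of_card_eq {σ : Type} [Fintype σ] (g : σ → MvPolynomial σ ℂ)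
    (r : MvPolynomial σ ℂ) :
    ∃ P : Polynomial (MvPolynomial σ ℂ), P ≠ 0 ∧
      P.eval₂ (aeval g : MvPolynomial σ ℂ →ₐ[ℂ] MvPolynomial σ ℂ).toRingHom r = 0 := by
  have hni : ¬ AlgebraicIndependent ℂ (fun o : Option σ => o.elim r g) := by
    intro h
    have h1 := h.cardinalMk_le_trdeg
    rw [MvPolynomial.trdeg_of_isDomain] at h1
    simp only [Cardinal.mk_fintype, Fintype.card_option, Cardinal.lift_natCast] at h1
    have h2 : Fintype.card σ + 1 ≤ Fintype.card σ := by exact_mod_cast h1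
    omega
  rw [algebraicIndependent_iff] at hni
  push Not at hni
  obtain ⟨p, hp, hp0⟩ := hni
  refine ⟨optionEquivLeft ℂ σ p, by simpa using hp0, ?_⟩
  rw [← hp]
  let φ : MvPolynomial (Option σ) ℂ →+* MvPolynomial σ ℂ :=
    (Polynomial.eval₂RingHom (aeval g : MvPolynomial σ ℂ →ₐ[ℂ] MvPolynomial σ ℂ).toRingHom r).comp
      (optionEquivLeft ℂ σ).toAlgHom.toRingHom
  have : φ = (aeval (fun o : Option σ => o.elim r g)).toRingHom := by
    apply MvPolynomial.ringHom_ext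
    · intro c
      simp [φ, optionEquivLeft_C]
    · rintro (_ | i)
      · simp [φ, optionEquivLeft_X_none]
      · simp [φ, optionEquivLeft_X_some]
  exact congrArg (fun ψ => ψ p) this

/-- A separable relation for `r` over the image of `g`, whose constant term does not vanish
when `r ≠ 0`. -/
theorem exists_separable_relation {σ : Type} [Fintype σ] (g : σ → MvPolynomial σ ℂ)
    (hg : AlgebraicIndependent ℂ g) (r : MvPolynomial σ ℂ) :
    ∃ P : Polynomial (MvPolynomial σ ℂ),
      P.eval₂ (aeval g : MvPolynomial σ ℂ →ₐ[ℂ] MvPolynomial σ ℂ).toRingHom r = 0 ∧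
      P.derivative.eval₂ (aeval g : MvPolynomial σ ℂ →ₐ[ℂ] MvPolynomial σ ℂ).toRingHom r ≠ 0 ∧
      (r ≠ 0 → P.coeff 0 ≠ 0) := by
  classical
  set φ := (aeval g : MvPolynomial σ ℂ →ₐ[ℂ] MvPolynomial σ ℂ).toRingHom with hφ
  have hinj : ∀ p, φ p = 0 → p = 0 := fun p hp => by
    by_contra h
    exact h ((algebraicIndependent_iff.1 hg) p hp)
  have hex : ∃ d : ℕ, ∃ P : Polynomial (MvPolynomial σ ℂ), P ≠ 0 ∧ P.eval₂ φ r = 0 ∧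
      P.natDegree = d := by
    obtain ⟨P, h0, h1⟩ := exists_relation_of_card_eq g r
    exact ⟨_, P, h0, h1, rfl⟩
  obtain ⟨P, hP0, hPr, hPd⟩ := Nat.find_spec hex
  have hmin : ∀ Q : Polynomial (MvPolynomial σ ℂ), Q ≠ 0 → Q.eval₂ φ r = 0 →
      P.natDegree ≤ Q.natDegree := fun Q h0 h1 => by
    rw [hPd]
    exact Nat.find_min' hex ⟨Q, h0, h1, rfl⟩
  have hdeg : P.natDegree ≠ 0 := by
    intro h
    rw [Polynomial.eq_C_of_natDegree_eq_zero h] at hPr hP0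
    rw [Polynomial.eval₂_C] at hPr
    exact hP0 (by rw [hinj _ hPr, map_zero])
  refine ⟨P, hPr, fun h => ?_, fun hr h => ?_⟩
  · have hd0 : P.derivative ≠ 0 := fun h0 =>
      hdeg (Polynomial.derivative_eq_zero.1 h0)
    have h1 := hmin _ hd0 h
    have h2 := Polynomial.natDegree_derivative_lt hdeg
    omega
  · have h1 := Polynomial.X_mul_divX_add P
    rw [h, map_zero, add_zero] at h1
    have h2 : P.divX ≠ 0 := by
      rintro h0
      rw [h0, mul_zero] at h1
      exact hP0 h1.symm
    have h3 : P.divX.eval₂ φ r = 0 := by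
      rw [← h1, Polynomial.eval₂_mul, Polynomial.eval₂_X] at hPr
      exact (mul_eq_zero.1 hPr).resolve_left hr
    have h4 := hmin _ h2 h3
    rw [Polynomial.natDegree_divX_eq_natDegree_tsub_one] at h4
    omega

/-- Algebraic Sard theorem: the values of a polynomial self-map of affine space at its critical
points, that is at the dual number points with nonzero tangent part which are mapped to
constants, lie in a hypersurface. -/
theorem exists_hypersurface_critical_values {σ : Type} [Fintype σ] (g : σ → MvPolynomial σ ℂ) :
    ∃ q : MvPolynomial σ ℂ, q ≠ 0 ∧ ∀ (Z : σ → DualNumber ℂ) (c : σ → ℂ),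
      (∀ i, aeval Z (g i) = algebraMap ℂ (DualNumber ℂ) (c i)) →
      (∃ l, (Z l).snd ≠ 0) → eval c q = 0 := by
  classical
  have hcomp : ∀ (Z : σ → DualNumber ℂ) (c : σ → ℂ),
      (∀ i, aeval Z (g i) = algebraMap ℂ (DualNumber ℂ) (c i)) → ∀ p : MvPolynomial σ ℂ,
      aeval Z (aeval g p) = algebraMap ℂ (DualNumber ℂ) (eval c p) := by
    intro Z c h p
    induction p using MvPolynomial.induction_on with
    | C a => simp
    | add p q hp hq => simp only [map_add, hp, hq]
    | mul_X p i hp => simp only [map_mul, hp, aeval_X, eval_X, h]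
  by_cases hg : AlgebraicIndependent ℂ g
  swap
  · rw [algebraicIndependent_iff] at hg
    push Not at hg
    obtain ⟨q, hq, hq0⟩ := hg
    refine ⟨q, hq0, fun Z c h _ => ?_⟩
    have h1 := hcomp Z c h q
    rw [hq, map_zero] at h1
    simpa using h1.symm
  set φ := (aeval g : MvPolynomial σ ℂ →ₐ[ℂ] MvPolynomial σ ℂ).toRingHom with hφ
  choose P hP hP' _ using fun l => exists_separable_relation g hg (X l)
  set D : MvPolynomial σ ℂ := ∏ l, (P l).derivative.eval₂ φ (X l) with hD
  have hD0 : D ≠ 0 := Finset.prod_ne_zero_iff.2 fun l _ => hP' l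
  obtain ⟨R, hR, -, hR0⟩ := exists_separable_relation g hg D
  refine ⟨R.coeff 0, hR0 hD0, fun Z c h ⟨l, hl⟩ => ?_⟩
  set z : σ → ℂ := fun i => (Z i).fst with hz
  have hfst : ∀ p : MvPolynomial σ ℂ, (aeval Z p).fst = eval z p := by
    intro p
    induction p using MvPolynomial.induction_on with
    | C a => simp [TrivSqZeroExt.algebraMap_eq_inl]
    | add p q hp hq => simp only [map_add, hp, hq, TrivSqZeroExt.fst_add]
    | mul_X p i hp => simp only [map_mul, hp, aeval_X, eval_X, TrivSqZeroExt.fst_mul, hz]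
  have hzc : ∀ p : MvPolynomial σ ℂ, eval z (φ p) = eval c p := by
    intro p
    rw [← hfst]
    change (aeval Z (aeval g p)).fst = _
    rw [hcomp Z c h]
    simp [TrivSqZeroExt.algebraMap_eq_inl]
  have hpoly : ∀ (Q : Polynomial (MvPolynomial σ ℂ)) (r : MvPolynomial σ ℂ),
      eval z (Q.eval₂ φ r) = (Q.map (eval c)).eval (eval z r) := by
    intro Q r
    rw [Polynomial.hom_eval₂, Polynomial.eval_map]
    congr 1
    exact RingHom.ext hzc
  have hdual : (Polynomial.aeval (Z l) ((P l).map (eval c))) = 0 := by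
    have h1 := congrArg (aeval Z) (hP l)
    rw [map_zero] at h1
    rw [← h1, Polynomial.aeval_def, Polynomial.eval₂_map]
    change _ = (aeval Z).toRingHom (Polynomial.eval₂ φ (X l) (P l))
    rw [Polynomial.hom_eval₂]
    have : (aeval Z).toRingHom.comp φ = (algebraMap ℂ (DualNumber ℂ)).comp (eval c) :=
      RingHom.ext (hcomp Z c h)
    rw [this]
    simp
  have hZl : Z l = algebraMap ℂ (DualNumber ℂ) (z l) + TrivSqZeroExt.inr (Z l).snd := by
    rw [TrivSqZeroExt.algebraMap_eq_inl, hz]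
    exact (TrivSqZeroExt.inl_fst_add_inr_snd_eq _).symm
  rw [hZl, Polynomial.aeval_add_of_sq_eq_zero _ _ _ (by rw [pow_two, TrivSqZeroExt.inr_mul_inr]),
    Polynomial.aeval_algebraMap_apply, Polynomial.aeval_algebraMap_apply] at hdual
  have h2 := congrArg TrivSqZeroExt.snd hdual
  simp [TrivSqZeroExt.algebraMap_eq_inl, hl] at h2
  have hDz : eval z D = 0 := by
    rw [hD, map_prod]
    refine Finset.prod_eq_zero (Finset.mem_univ l) ?_
    rw [hpoly, eval_X]
    simpa [Polynomial.derivative_map] using h2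
  have h3 := congrArg (eval z) hR
  rw [hpoly, hDz, map_zero, ← Polynomial.coeff_zero_eq_eval_zero, Polynomial.coeff_map] at h3
  exact h3

/-- The monomials which may occur in the `i`-th polynomial of a system with degrees in `A i`. -/
abbrev SystemIndex (n : ℕ) (A : Fin n → Finset ℕ) : Type :=
  Σ i : Fin n, {m : Fin n →₀ ℕ // m.degree ∈ A i}

instance finite_monomials (n : ℕ) (A : Finset ℕ) : Finite {m : Fin n →₀ ℕ // m.degree ∈ A} := by
  refine Set.Finite.subset (Finsupp.finite_of_degree_le (σ := Fin n) (A.sup id)) fun m hm => ?_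
  exact Finset.le_sup (f := id) hm

/-- The coefficients of a system of polynomials. -/
def systemCoeff {n : ℕ} (A : Fin n → Finset ℕ) (f : Fin n → MvPolynomial (Fin n) ℂ) :
    SystemIndex n A → ℂ := fun p => coeff p.2.1 (f p.1)

/-- All monomials of `f i` have degree in `A i`. -/
def HasDegrees {n : ℕ} (A : Fin n → Finset ℕ) (f : Fin n → MvPolynomial (Fin n) ℂ) : Prop :=
  ∀ i m, coeff m (f i) ≠ 0 → m.degree ∈ A i

/-- The system `f` has only nondegenerate zeros in `ℂⁿ \ {0}`: there is no dual number zero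
with nonzero base point and nonzero tangent part. -/
def IsNondegenerate {n : ℕ} (f : Fin n → MvPolynomial (Fin n) ℂ) : Prop :=
  ∀ X : Fin n → DualNumber ℂ, (∀ i, aeval X (f i) = 0) → (∃ j, (X j).fst ≠ 0) →
    ∀ j, (X j).snd = 0

theorem aeval_eq_sum_monomials {n : ℕ} {A : Fin n → Finset ℕ}
    {f : Fin n → MvPolynomial (Fin n) ℂ} (hf : HasDegrees A f) {R : Type*} [CommRing R]
    [Algebra ℂ R] (X : Fin n → R) (i : Fin n) [Fintype {m : Fin n →₀ ℕ // m.degree ∈ A i}] :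
    aeval X (f i) = ∑ m : {m : Fin n →₀ ℕ // m.degree ∈ A i},
      algebraMap ℂ R (coeff m.1 (f i)) * ∏ l, X l ^ m.1 l := by
  classical
  rw [aeval_def, eval₂_eq']
  refine Eq.trans ?_ (Finset.sum_map Finset.univ (Function.Embedding.subtype _)
    (fun m : Fin n →₀ ℕ => algebraMap ℂ R (coeff m (f i)) * ∏ l, X l ^ m l))
  refine Finset.sum_subset ?_ ?_
  · intro m hm
    simpa using hf i m (mem_support_iff.1 hm)
  · intro m _ hm
    rw [notMem_support_iff.1 hm, map_zero, zero_mul]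

theorem exists_hypersurface_degenerate_patch {n : ℕ} {A : Fin n → Finset ℕ}
    (hA : ∀ i, (A i).Nonempty) (j : Fin n) :
    ∃ q : MvPolynomial (SystemIndex n A) ℂ, q ≠ 0 ∧
      ∀ f : Fin n → MvPolynomial (Fin n) ℂ, HasDegrees A f →
      ∀ X : Fin n → DualNumber ℂ, (∀ i, aeval X (f i) = 0) → (X j).fst ≠ 0 →
        (∃ l, (X l).snd ≠ 0) → eval (systemCoeff A f) q = 0 := by
  classical
  have hfin : ∀ i, Fintype {m : Fin n →₀ ℕ // m.degree ∈ A i} := fun i => Fintype.ofFinite _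
  set b : Fin n → ℕ := fun i => (A i).max' (hA i) with hb
  have hspm : ∀ i, (Finsupp.single j (b i)).degree ∈ A i := fun i => by
    rw [Finsupp.degree_single]
    exact Finset.max'_mem _ _
  set sp : ∀ i, {m : Fin n →₀ ℕ // m.degree ∈ A i} := fun i => ⟨Finsupp.single j (b i), hspm i⟩
    with hsp
  set W : Fin n → MvPolynomial (SystemIndex n A) ℂ := fun l => if l = j then 1 else X ⟨l, sp l⟩
    with hW
  set g : SystemIndex n A → MvPolynomial (SystemIndex n A) ℂ := fun p =>
    if p.2 = sp p.1 then
      - ∑ m ∈ Finset.univ.erase (sp p.1), X ⟨p.1, m⟩ *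
        (X ⟨j, sp j⟩ ^ (b p.1 - m.1.degree) * ∏ l, W l ^ m.1 l)
    else X p with hg
  obtain ⟨q, hq0, hq⟩ := exists_hypersurface_critical_values g
  refine ⟨q, hq0, fun f hf T hT hTj ⟨l, hl⟩ => ?_⟩
  obtain ⟨u, hu⟩ := TrivSqZeroExt.isUnit_iff_isUnit_fst.2 (isUnit_iff_ne_zero.2 hTj)
  set μ : DualNumber ℂ := ((u⁻¹ : (DualNumber ℂ)ˣ) : DualNumber ℂ) with hμ
  have hμT : μ * T j = 1 := by rw [hμ, ← hu]; exact u.inv_mul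
  set Y : Fin n → DualNumber ℂ := fun i => if i = j then μ else μ * T i with hY
  set Z : SystemIndex n A → DualNumber ℂ := fun p =>
    if p.2 = sp p.1 then Y p.1 else algebraMap ℂ _ (systemCoeff A f p) with hZ
  have hZsp : ∀ i, Z ⟨i, sp i⟩ = Y i := fun i => by simp [hZ]
  have hZW : ∀ i, aeval Z (W i) = μ * T i := by
    intro i
    by_cases hi : i = j
    · simp [hW, hi, hμT]
    · simp [hW, hi, hZsp, hY]
  refine hq Z _ ?_ ?_
  · rintro ⟨i, m⟩
    by_cases hm : m = sp i
    swap
    · simp [hg, hm, hZ]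
    subst hm
    simp only [hg, if_true, map_neg, map_sum, map_mul, map_pow, map_prod, aeval_X, hZW, hZsp]
    have hYj : Y j = μ := by simp [hY]
    rw [hYj]
    have key : ∀ m : {m : Fin n →₀ ℕ // m.degree ∈ A i},
        μ ^ (b i - m.1.degree) * ∏ l, (μ * T l) ^ m.1 l = μ ^ b i * ∏ l, T l ^ m.1 l := by
      intro m
      have h1 : m.1.degree ≤ b i := Finset.le_max' _ _ m.2
      have h2 : ∏ l, μ ^ m.1 l = μ ^ m.1.degree := by
        rw [Finset.prod_pow_eq_pow_sum, Finsupp.degree_eq_sum]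
      simp only [mul_pow, Finset.prod_mul_distrib]
      rw [h2, ← mul_assoc, ← pow_add, Nat.sub_add_cancel h1]
    have h0 := hT i
    rw [aeval_eq_sum_monomials hf] at h0
    have h1 : ∑ m : {m : Fin n →₀ ℕ // m.degree ∈ A i},
        algebraMap ℂ (DualNumber ℂ) (coeff m.1 (f i)) *
          (μ ^ (b i - m.1.degree) * ∏ l, (μ * T l) ^ m.1 l) = 0 := by
      rw [← mul_zero (μ ^ b i), ← h0, Finset.mul_sum]
      refine Finset.sum_congr rfl fun m _ => ?_
      rw [key]
      ring
    rw [← Finset.add_sum_erase _ _ (Finset.mem_univ (sp i)), key (sp i)] at h1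
    have h2 : μ ^ b i * ∏ l, T l ^ (sp i).1 l = 1 := by
      have : ∏ l, T l ^ (sp i).1 l = T j ^ b i := by
        rw [Finset.prod_eq_single j]
        · simp [hsp]
        · intro l _ hl
          simp [hsp, Ne.symm hl]
        · simp
      rw [this, ← mul_pow, hμT, one_pow]
    rw [h2, mul_one] at h1
    rw [neg_eq_iff_add_eq_zero, add_comm, ← h1]
    congr 1
    refine Finset.sum_congr rfl fun m hm => ?_
    simp [hZ, (Finset.mem_erase.1 hm).1, systemCoeff]
  · by_contra! hcon
    have hYs : ∀ i, (Y i).snd = 0 := fun i => by rw [← hZsp]; exact hcon _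
    have hμs : μ.snd = 0 := by simpa [hY] using hYs j
    have hμf : μ.fst ≠ 0 := by
      intro h
      have := congrArg TrivSqZeroExt.fst hμT
      simp [h] at this
    apply hl
    by_cases hlj : l = j
    · have := congrArg TrivSqZeroExt.snd hμT
      rw [hlj]
      simpa [hμs, hμf] using this
    · have := hYs l
      simpa [hY, hlj, hμs, hμf] using this

theorem exists_hypersurface_degenerate {n : ℕ} {A : Fin n → Finset ℕ}
    (hA : ∀ i, (A i).Nonempty) :
    ∃ q : MvPolynomial (SystemIndex n A) ℂ, q ≠ 0 ∧
      ∀ f : Fin n → MvPolynomial (Fin n) ℂ, HasDegrees A f →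
        eval (systemCoeff A f) q ≠ 0 → IsNondegenerate f := by
  choose q hq0 hq using fun j => exists_hypersurface_degenerate_patch hA j
  refine ⟨∏ j, q j, Finset.prod_ne_zero_iff.2 fun j _ => hq0 j, fun f hf h => ?_⟩
  rintro X hX ⟨j, hj⟩
  by_contra! hcon
  refine h ?_
  rw [map_prod]
  exact Finset.prod_eq_zero (Finset.mem_univ j) (hq j f hf X hX hj hcon)

/-- A system with monomials of degrees in `[a i, b i]` which has only nondegenerate zeros in
`ℂⁿ \ {0}`, and none at infinity or infinitely near to the origin. -/
structure IsRegularSystem {n : ℕ} (a b : Fin n → ℕ) (f : Fin n → MvPolynomial (Fin n) ℂ) :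
    Prop where
  hasDegrees : HasDegrees (fun i => Finset.Icc (a i) (b i)) f
  top : ∀ x : Fin n → ℂ, x ≠ 0 → ∃ i, eval x (homogeneousComponent (b i) (f i)) ≠ 0
  low : ∀ x : Fin n → ℂ, x ≠ 0 → ∃ i, eval x (homogeneousComponent (a i) (f i)) ≠ 0
  nondegenerate : IsNondegenerate f

theorem aeval_mul_of_isHomogeneous {σ R : Type*} [CommRing R] [Algebra ℂ R]
    {p : MvPolynomial σ ℂ} {d : ℕ} (hp : p.IsHomogeneous d) (r : R) (x : σ → R) :
    aeval (fun i => r * x i) p = r ^ d * aeval x p := by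
  simp only [aeval_def, eval₂_eq, Finset.mul_sum]
  refine Finset.sum_congr rfl fun m hm => ?_
  rw [hp.degree_eq_sum_deg_support hm]
  simp only [mul_pow, Finset.prod_mul_distrib, Finset.prod_pow_eq_pow_sum]
  ring

theorem IsNondegenerate.exists_eval_ne_zero {n : ℕ} {d : Fin n → ℕ}
    {f : Fin n → MvPolynomial (Fin n) ℂ} (hf : IsNondegenerate f)
    (hd : ∀ i, (f i).IsHomogeneous (d i)) (x : Fin n → ℂ) (hx : x ≠ 0) :
    ∃ i, eval x (f i) ≠ 0 := by
  by_contra! hcon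
  obtain ⟨j, hj⟩ := Function.ne_iff.1 hx
  have h := hf (fun i => (1 + DualNumber.eps) * algebraMap ℂ (DualNumber ℂ) (x i)) (fun i => by
    rw [aeval_mul_of_isHomogeneous (hd i)]
    have : aeval (fun i => algebraMap ℂ (DualNumber ℂ) (x i)) (f i)
        = algebraMap ℂ (DualNumber ℂ) (eval x (f i)) := by
      have h := aeval_algebraMap_apply (A := ℂ) (DualNumber ℂ) x (f i)
      exact h
    rw [this, hcon, map_zero, mul_zero])
    ⟨j, by simpa [TrivSqZeroExt.algebraMap_eq_inl] using hj⟩ j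
  simp [TrivSqZeroExt.algebraMap_eq_inl] at h
  exact hj h

theorem exists_hypersurface_component {n : ℕ} {A : Fin n → Finset ℕ} (d : Fin n → ℕ)
    (hd : ∀ i, d i ∈ A i) :
    ∃ q : MvPolynomial (SystemIndex n A) ℂ, q ≠ 0 ∧
      ∀ f : Fin n → MvPolynomial (Fin n) ℂ, eval (systemCoeff A f) q ≠ 0 →
        ∀ x : Fin n → ℂ, x ≠ 0 → ∃ i, eval x (homogeneousComponent (d i) (f i)) ≠ 0 := by
  obtain ⟨q, hq0, hq⟩ := exists_hypersurface_degenerate (A := fun i => {d i})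
    (fun i => Finset.singleton_nonempty _)
  let ι : SystemIndex n (fun i => {d i}) → SystemIndex n A := fun p =>
    ⟨p.1, ⟨p.2.1, by rw [Finset.mem_singleton.1 p.2.2]; exact hd _⟩⟩
  have hι : Function.Injective ι := by
    rintro ⟨i, m, hm⟩ ⟨i', m', hm'⟩ h
    simp only [ι, Sigma.mk.injEq] at h
    obtain ⟨rfl, h⟩ := h
    simpa using h
  refine ⟨rename ι q, fun h => hq0 (rename_injective ι hι (by rw [h, map_zero])),
    fun f hf => ?_⟩
  have hnd : IsNondegenerate fun i => homogeneousComponent (d i) (f i) := by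
    refine hq _ ?_ ?_
    · intro i m hm
      rw [coeff_homogeneousComponent] at hm
      by_contra hcon
      exact hm (if_neg (by simpa using hcon))
    · convert hf using 1
      rw [eval_rename]
      congr 2
      ext ⟨i, m, hm⟩
      simp only [systemCoeff, Function.comp, ι, coeff_homogeneousComponent]
      exact if_pos (Finset.mem_singleton.1 hm)
  exact hnd.exists_eval_ne_zero fun i => homogeneousComponent_isHomogeneous _ _

theorem exists_hypersurface_not_regular {n : ℕ} {A : Fin n → Finset ℕ}
    (hA : ∀ i, (A i).Nonempty) :
    ∃ q : MvPolynomial (SystemIndex n A) ℂ, q ≠ 0 ∧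
      ∀ f : Fin n → MvPolynomial (Fin n) ℂ, HasDegrees A f →
        eval (systemCoeff A f) q ≠ 0 →
        IsRegularSystem (fun i => (A i).min' (hA i)) (fun i => (A i).max' (hA i)) f := by
  obtain ⟨q₁, h₁, H₁⟩ := exists_hypersurface_degenerate hA
  obtain ⟨q₂, h₂, H₂⟩ := exists_hypersurface_component (A := A) _
    (fun i => (A i).max'_mem (hA i))
  obtain ⟨q₃, h₃, H₃⟩ := exists_hypersurface_component (A := A) _
    (fun i => (A i).min'_mem (hA i))
  refine ⟨q₁ * (q₂ * q₃), mul_ne_zero h₁ (mul_ne_zero h₂ h₃), fun f hf h => ?_⟩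
  simp only [map_mul, ne_eq, mul_eq_zero, not_or] at h
  refine ⟨fun i m hm => ?_, H₂ f h.2.1, H₃ f h.2.2, H₁ f hf h.1⟩
  exact Finset.mem_Icc.2 ⟨Finset.min'_le _ _ (hf i m hm), Finset.le_max' _ _ (hf i m hm)⟩

section PersistenceOfZeros

open Topology Filter

theorem finite_of_locally_unique {E : Type*} [TopologicalSpace E] {Z : Set E} (hZ : IsCompact Z)
    (h : ∀ x ∈ Z, ∃ U ∈ 𝓝 x, (U ∩ Z).Subsingleton) : Z.Finite := by
  choose! U hU hUZ using h
  obtain ⟨s, hs, hcov⟩ := hZ.elim_nhds_subcover U hU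
  refine (s.finite_toSet.biUnion (t := fun x => U x ∩ Z) fun x hx => (hUZ x (hs x hx)).finite).subset
    fun z hz => ?_
  obtain ⟨x, hx, hzx⟩ := Set.mem_iUnion₂.1 (hcov hz)
  exact Set.mem_iUnion₂.2 ⟨x, hx, hzx, hz⟩

/-- The number of zeros in an open set `Ω` of a continuous family is locally constant, provided
the zeros stay in a compact subset of `Ω` and persist locally uniquely. -/
theorem ncard_zeros_eventually_eq {T E E' : Type*} [TopologicalSpace T] [TopologicalSpace E]
    [T2Space E] [TopologicalSpace E'] [T2Space E'] [Zero E'] {F : T → E → E'}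
    (hF : Continuous (Function.uncurry F)) {K Ω : Set E} (hK : IsCompact K) (hΩ : IsOpen Ω)
    (hKΩ : K ⊆ Ω) {t₀ : T} (hZK : ∀ᶠ t in 𝓝 t₀, {x | x ∈ Ω ∧ F t x = 0} ⊆ K)
    (hloc : ∀ x ∈ Ω, F t₀ x = 0 → ∃ U ∈ 𝓝 x, ∀ V ∈ 𝓝 x, V ⊆ U →
      ∀ᶠ t in 𝓝 t₀, ∃! y, y ∈ V ∧ F t y = 0) :
    {x | x ∈ Ω ∧ F t₀ x = 0}.Finite ∧ ∀ᶠ t in 𝓝 t₀,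
      {x | x ∈ Ω ∧ F t x = 0}.ncard = {x | x ∈ Ω ∧ F t₀ x = 0}.ncard := by
  classical
  set Z₀ : Set E := {x | x ∈ Ω ∧ F t₀ x = 0} with hZ₀
  have hcomp : IsCompact Z₀ := by
    have h1 : Z₀ = K ∩ F t₀ ⁻¹' {0} := by
      ext x
      constructor
      · exact fun hx => ⟨hZK.self_of_nhds hx, hx.2⟩
      · exact fun hx => ⟨hKΩ hx.1, hx.2⟩
    rw [h1]
    exact hK.inter_right (isClosed_singleton.preimage
      (hF.comp (Continuous.prodMk_right t₀)))
  choose! U hU hUV using hloc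
  have hfin : Z₀.Finite := by
    refine finite_of_locally_unique hcomp fun x hx => ⟨U x, hU x hx.1 hx.2, ?_⟩
    obtain ⟨y, -, hy⟩ := (hUV x hx.1 hx.2 (U x) (hU x hx.1 hx.2) subset_rfl).self_of_nhds
    exact fun u hu v hv => (hy u ⟨hu.1, hu.2.2⟩).trans (hy v ⟨hv.1, hv.2.2⟩).symm
  refine ⟨hfin, ?_⟩
  obtain ⟨W, hW, hWd⟩ := hfin.t2_separation
  set V : E → Set E := fun x => W x ∩ interior (U x) ∩ Ω with hV
  have hVo : ∀ x, IsOpen (V x) := fun x => ((hW x).2.inter isOpen_interior).inter hΩ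
  have hVx : ∀ x ∈ Z₀, x ∈ V x := fun x hx =>
    ⟨⟨(hW x).1, mem_interior_iff_mem_nhds.2 (hU x hx.1 hx.2)⟩, hx.1⟩
  have hVU : ∀ x, V x ⊆ U x := fun x y hy => interior_subset hy.1.2
  have h1 : ∀ᶠ t in 𝓝 t₀, ∀ x ∈ Z₀, ∃! y, y ∈ V x ∧ F t y = 0 :=
    (eventually_all_finite hfin).2 fun x hx =>
      hUV x hx.1 hx.2 _ ((hVo x).mem_nhds (hVx x hx)) (hVU x)
  have h2 : ∀ᶠ t in 𝓝 t₀, ∀ y ∈ K \ ⋃ x ∈ Z₀, V x, F t y ≠ 0 := by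
    refine (hK.diff (isOpen_biUnion fun x _ => hVo x)).eventually_forall_of_forall_eventually
      fun y hy => ?_
    have : Function.uncurry F (t₀, y) ≠ 0 := fun h =>
      hy.2 (Set.mem_iUnion₂.2 ⟨y, ⟨hKΩ hy.1, h⟩, hVx y ⟨hKΩ hy.1, h⟩⟩)
    exact hF.continuousAt.eventually_ne this
  filter_upwards [h1, h2, hZK] with t h1 h2 h3
  choose! y hy hyu using h1
  symm
  refine Set.ncard_congr (fun x _ => y x) (fun x hx => ⟨(hy x hx).1.2, (hy x hx).2⟩) ?_ ?_
  · intro x x' hx hx' h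
    by_contra hne
    refine Set.disjoint_left.1 (hWd hx hx' hne) (hy x hx).1.1.1 ?_
    have h' : y x = y x' := h
    rw [h']
    exact (hy x' hx').1.1.1
  · intro z hz
    by_cases hzV : z ∈ ⋃ x ∈ Z₀, V x
    · obtain ⟨x, hx, hzx⟩ := Set.mem_iUnion₂.1 hzV
      exact ⟨x, hx, (hyu x hx z ⟨hzx, hz.2⟩).symm⟩
    · exact absurd hz.2 (h2 z ⟨h3 hz, hzV⟩)

/-- Locally unique persistence of a nondegenerate zero. -/
theorem exists_nhds_existsUnique_zero {E : Type*} [NormedAddCommGroup E] [NormedSpace ℂ E]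
    [CompleteSpace E] {F : ℂ → E → E} {t₀ : ℂ} {x₀ : E} (h0 : F t₀ x₀ = 0)
    {F' : (ℂ × E) ≃L[ℂ] (ℂ × E)}
    (hF : HasStrictFDerivAt (fun p : ℂ × E => (p.1, F p.1 p.2)) (F' : (ℂ × E) →L[ℂ] (ℂ × E))
      (t₀, x₀)) :
    ∃ U ∈ 𝓝 x₀, ∀ V ∈ 𝓝 x₀, V ⊆ U → ∀ᶠ t in 𝓝 t₀, ∃! y, y ∈ V ∧ F t y = 0 := by
  set φ := hF.toOpenPartialHomeomorph with hφ
  have hsrc : φ.source ∈ 𝓝 (t₀, x₀) :=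
    φ.open_source.mem_nhds hF.mem_toOpenPartialHomeomorph_source
  rw [nhds_prod_eq] at hsrc
  obtain ⟨T, hT, U, hU, hTU⟩ := Filter.mem_prod_iff.1 hsrc
  refine ⟨U, hU, fun V hV hVU => ?_⟩
  have hmap := hF.map_nhds_eq_of_equiv
  have himg : (fun p : ℂ × E => (p.1, F p.1 p.2)) '' (T ×ˢ V) ∈ 𝓝 (t₀, (0 : E)) := by
    have := Filter.image_mem_map (m := fun p : ℂ × E => (p.1, F p.1 p.2)) (prod_mem_nhds hT hV)
    rw [hmap] at this
    simpa [h0] using this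
  have hc : Tendsto (fun t : ℂ => (t, (0 : E))) (𝓝 t₀) (𝓝 (t₀, 0)) :=
    (Continuous.prodMk_left (0 : E)).tendsto t₀
  filter_upwards [hc himg, hT] with t ht htT
  obtain ⟨⟨t', y⟩, ⟨-, hyV⟩, hy⟩ := ht
  simp only [Prod.mk.injEq] at hy
  obtain ⟨rfl, hy⟩ := hy
  refine ⟨y, ⟨hyV, hy⟩, fun z hz => ?_⟩
  have h1 : (t', z) ∈ φ.source := hTU ⟨htT, hVU hz.1⟩
  have h2 : (t', y) ∈ φ.source := hTU ⟨htT, hVU hyV⟩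
  have h3 : φ (t', z) = φ (t', y) := by
    change (t', F t' z) = (t', F t' y)
    rw [hz.2, hy]
  exact (Prod.mk.inj (φ.injOn h1 h2 h3)).2

theorem sum_eval_pderiv_mul_X {n : ℕ} (p : MvPolynomial (Fin n) ℂ) (i : Fin n)
    (x v : Fin n → ℂ) :
    ∑ l, eval x (pderiv l (p * X i)) * v l =
      eval x p * v i + x i * ∑ l, eval x (pderiv l p) * v l := by
  have h : ∀ l, eval x (pderiv l (p * X i)) * v l =
      (if l = i then eval x p * v l else 0) + x i * (eval x (pderiv l p) * v l) := by
    intro l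
    by_cases hl : l = i
    · subst hl
      simp [Derivation.leibniz]
      ring
    · simp [Derivation.leibniz, pderiv_X_of_ne (Ne.symm hl), hl]
      ring
  simp only [h, Finset.sum_add_distrib, Finset.mul_sum]
  simp

theorem hasStrictFDerivAt_eval {n : ℕ} (p : MvPolynomial (Fin n) ℂ) (x : Fin n → ℂ) :
    HasStrictFDerivAt (fun x : Fin n → ℂ => eval x p)
      (∑ l, eval x (pderiv l p) • ContinuousLinearMap.proj (R := ℂ) (φ := fun _ : Fin n => ℂ) l)
      x := by
  induction p using MvPolynomial.induction_on with
  | C a =>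
    simp only [eval_C]
    refine (hasStrictFDerivAt_const (𝕜 := ℂ) a x).congr_fderiv ?_
    ext1 v
    simp
  | add p q hp hq =>
    simp only [map_add]
    refine (hp.fun_add hq).congr_fderiv ?_
    ext1 v
    simp [add_mul, Finset.sum_add_distrib]
  | mul_X p i hp =>
    simp only [map_mul, eval_X]
    refine (hp.fun_mul (hasStrictFDerivAt_apply i x)).congr_fderiv ?_
    ext1 v
    have := sum_eval_pderiv_mul_X p i x v
    simp only [add_apply, smul_apply, sum_apply, ContinuousLinearMap.proj_apply, smul_eq_mul]
    exact this.symm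

theorem aeval_dualNumber {n : ℕ} (p : MvPolynomial (Fin n) ℂ) (x v : Fin n → ℂ) :
    aeval (fun l => (TrivSqZeroExt.inl (x l) + TrivSqZeroExt.inr (v l) : DualNumber ℂ)) p =
      TrivSqZeroExt.inl (eval x p) + TrivSqZeroExt.inr (∑ l, eval x (pderiv l p) * v l) := by
  induction p using MvPolynomial.induction_on with
  | C a => simp [TrivSqZeroExt.algebraMap_eq_inl]
  | add p q hp hq =>
    rw [map_add, hp, hq]
    ext <;> simp [add_mul, Finset.sum_add_distrib]
  | mul_X p i hp =>
    rw [sum_eval_pderiv_mul_X, map_mul, hp, aeval_X]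
    ext
    · simp
    · simp
      ring

/-- The zeros of a system in `ℂⁿ \ {0}`. -/
def puncturedZeros {n : ℕ} (f : Fin n → MvPolynomial (Fin n) ℂ) : Set (Fin n → ℂ) :=
  {x | x ≠ 0 ∧ ∀ i, eval x (f i) = 0}

theorem IsNondegenerate.exists_nhds_existsUnique_zero {n : ℕ}
    {f : Fin n → MvPolynomial (Fin n) ℂ} (hf : IsNondegenerate f)
    (g : Fin n → MvPolynomial (Fin n) ℂ) {x : Fin n → ℂ} (hx : x ≠ 0)
    (hfx : ∀ i, eval x (f i) = 0) :
    ∃ U ∈ 𝓝 x, ∀ V ∈ 𝓝 x, V ⊆ U → ∀ᶠ t in 𝓝 (0 : ℂ),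
      ∃! y, y ∈ V ∧ (fun i => eval y (f i) + t * eval y (g i)) = 0 := by
  set D : (Fin n → MvPolynomial (Fin n) ℂ) → (Fin n → ℂ) →L[ℂ] (Fin n → ℂ) := fun h =>
    ContinuousLinearMap.pi fun i => ∑ l, eval x (pderiv l (h i)) •
      ContinuousLinearMap.proj (R := ℂ) (φ := fun _ : Fin n => ℂ) l with hD
  have hstrict : ∀ h : Fin n → MvPolynomial (Fin n) ℂ,
      HasStrictFDerivAt (fun y : Fin n → ℂ => fun i => eval y (h i)) (D h) x := fun h =>
    hasStrictFDerivAt_pi.2 fun i => hasStrictFDerivAt_eval (h i) x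
  have hsnd : HasStrictFDerivAt (Prod.snd : ℂ × (Fin n → ℂ) → (Fin n → ℂ))
      (ContinuousLinearMap.snd ℂ ℂ (Fin n → ℂ)) (0, x) := hasStrictFDerivAt_snd
  have hfst : HasStrictFDerivAt (Prod.fst : ℂ × (Fin n → ℂ) → ℂ)
      (ContinuousLinearMap.fst ℂ ℂ (Fin n → ℂ)) (0, x) := hasStrictFDerivAt_fst
  have hF1 := (HasStrictFDerivAt.comp (0, x) (hstrict f) hsnd).add
    (hfst.smul (HasStrictFDerivAt.comp (0, x) (hstrict g) hsnd))
  have hF2 := hfst.prodMk hF1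
  set L : (ℂ × (Fin n → ℂ)) →L[ℂ] (ℂ × (Fin n → ℂ)) :=
    (ContinuousLinearMap.fst ℂ ℂ (Fin n → ℂ)).prod _ with hL
  have hLinj : Function.Injective (L : (ℂ × (Fin n → ℂ)) →ₗ[ℂ] (ℂ × (Fin n → ℂ))) := by
    rw [← LinearMap.ker_eq_bot, LinearMap.ker_eq_bot']
    rintro ⟨τ, v⟩ h
    have h1 := congrArg Prod.fst h
    have h2 := congrArg Prod.snd h
    simp [hL] at h1
    subst h1
    have h3 : D f v = 0 := by simpa [hL] using h2
    have h4 : v = 0 := by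
      ext j
      have := hf (fun l => TrivSqZeroExt.inl (x l) + TrivSqZeroExt.inr (v l)) (fun i => by
        rw [aeval_dualNumber, hfx]
        have := congrFun h3 i
        simp [hD] at this
        simp [this]) (by simpa using Function.ne_iff.1 hx) j
      simpa using this
    rw [h4]; rfl
  let e := (LinearEquiv.ofInjectiveEndo _ hLinj).toContinuousLinearEquiv
  have he : (e : (ℂ × (Fin n → ℂ)) →L[ℂ] (ℂ × (Fin n → ℂ))) = L := by
    ext1 <;> rfl
  refine _root_.exists_nhds_existsUnique_zero (F := fun t y i => eval y (f i) + t * eval y (g i))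
    (F' := e) (by ext i; simp [hfx]) ?_
  rw [he]
  exact hF2

/-- The weighted homogenization of `f + t g` with respect to a weight `w` does not vanish near
`t = 0`, `μ = 0` on the unit sphere, if the part of weight zero of `f` does not. -/
theorem eventually_forall_sphere_homogenization_ne_zero {n : ℕ} {A : Fin n → Finset ℕ}
    {f : Fin n → MvPolynomial (Fin n) ℂ} (g : Fin n → MvPolynomial (Fin n) ℂ)
    (hf : HasDegrees A f) [∀ i, Fintype {m : Fin n →₀ ℕ // m.degree ∈ A i}]
    (w : Fin n → ℕ → ℕ) (d : Fin n → ℕ) (hw : ∀ i, ∀ k ∈ A i, w i k = 0 ↔ k = d i)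
    (hd : ∀ x : Fin n → ℂ, x ≠ 0 → ∃ i, eval x (homogeneousComponent (d i) (f i)) ≠ 0) :
    ∀ᶠ p : ℂ × ℂ in 𝓝 (0, 0), ∀ u ∈ Metric.sphere (0 : Fin n → ℂ) 1,
      (fun i => ∑ m : {m : Fin n →₀ ℕ // m.degree ∈ A i},
        (coeff m.1 (f i) + p.1 * coeff m.1 (g i)) * (p.2 ^ w i m.1.degree * ∏ l, u l ^ m.1 l))
        ≠ 0 := by
  refine (isCompact_sphere (0 : Fin n → ℂ) 1).eventually_forall_of_forall_eventually
    fun u hu => ?_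
  have hu0 : u ≠ 0 := by
    rintro rfl
    simp at hu
  have hcont : Continuous (fun q : (ℂ × ℂ) × (Fin n → ℂ) => fun i : Fin n =>
      ∑ m : {m : Fin n →₀ ℕ // m.degree ∈ A i},
        (coeff m.1 (f i) + q.1.1 * coeff m.1 (g i)) *
          (q.1.2 ^ w i m.1.degree * ∏ l, q.2 l ^ m.1 l)) := by
    fun_prop
  refine hcont.continuousAt.eventually_ne ?_
  obtain ⟨i, hi⟩ := hd u hu0
  refine fun h => hi ?_
  refine Eq.trans ?_ (congrFun h i)
  have hdeg : HasDegrees A fun i => homogeneousComponent (d i) (f i) := by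
    intro i m hm
    rw [coeff_homogeneousComponent] at hm
    split_ifs at hm
    · exact hf i m hm
    · exact absurd rfl hm
  rw [← coe_aeval_eq_eval]
  change aeval u (homogeneousComponent (d i) (f i)) = _
  rw [aeval_eq_sum_monomials hdeg]
  refine Finset.sum_congr rfl fun m _ => ?_
  rw [coeff_homogeneousComponent]
  by_cases hm : m.1.degree = d i
  · rw [if_pos hm, (hw i _ m.2).2 hm]
    simp
  · rw [if_neg hm, zero_pow (fun h => hm ((hw i _ m.2).1 h))]
    simp

theorem eval_add_C_mul_eq_sum {n : ℕ} {A : Fin n → Finset ℕ}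
    {f g : Fin n → MvPolynomial (Fin n) ℂ} (hf : HasDegrees A f) (hg : HasDegrees A g)
    [∀ i, Fintype {m : Fin n →₀ ℕ // m.degree ∈ A i}] (t : ℂ) (x : Fin n → ℂ) (i : Fin n) :
    eval x (f i) + t * eval x (g i) = ∑ m : {m : Fin n →₀ ℕ // m.degree ∈ A i},
      (coeff m.1 (f i) + t * coeff m.1 (g i)) * ∏ l, x l ^ m.1 l := by
  rw [← coe_aeval_eq_eval]
  change aeval x (f i) + t * aeval x (g i) = _
  rw [aeval_eq_sum_monomials hf, aeval_eq_sum_monomials hg, Finset.mul_sum,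
    ← Finset.sum_add_distrib]
  refine Finset.sum_congr rfl fun m _ => ?_
  simp only [Algebra.algebraMap_self, RingHom.id_apply]
  ring

theorem prod_smul_pow {n : ℕ} (c : ℂ) (u : Fin n → ℂ) (m : Fin n →₀ ℕ) :
    ∏ l, (c • u) l ^ m l = c ^ m.degree * ∏ l, u l ^ m l := by
  simp only [Pi.smul_apply, smul_eq_mul, mul_pow, Finset.prod_mul_distrib]
  rw [Finset.prod_pow_eq_pow_sum, Finsupp.degree_eq_sum]

/-- The zeros of a small perturbation of a regular system stay in a fixed compact annulus. -/
theorem IsRegularSystem.exists_annulus {n : ℕ} {a b : Fin n → ℕ}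
    {f : Fin n → MvPolynomial (Fin n) ℂ} (hf : IsRegularSystem a b f)
    {g : Fin n → MvPolynomial (Fin n) ℂ}
    (hg : HasDegrees (fun i => Finset.Icc (a i) (b i)) g) :
    ∃ r > 0, ∃ R : ℝ, ∀ᶠ t in 𝓝 (0 : ℂ), ∀ x : Fin n → ℂ, x ≠ 0 →
      (∀ i, eval x (f i) + t * eval x (g i) = 0) → r ≤ ‖x‖ ∧ ‖x‖ ≤ R := by
  have hfin : ∀ i, Fintype {m : Fin n →₀ ℕ // m.degree ∈ Finset.Icc (a i) (b i)} :=
    fun i => @Fintype.ofFinite _ (finite_monomials n (Finset.Icc (a i) (b i)))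
  have htop := eventually_forall_sphere_homogenization_ne_zero g hf.hasDegrees
    (fun i k => b i - k) b (fun i k hk => by have := Finset.mem_Icc.1 hk; omega) hf.top
  have hlow := eventually_forall_sphere_homogenization_ne_zero g hf.hasDegrees
    (fun i k => k - a i) a (fun i k hk => by have := Finset.mem_Icc.1 hk; omega) hf.low
  rw [nhds_prod_eq] at htop hlow
  obtain ⟨P, hP, P', hP', htop⟩ := Filter.eventually_prod_iff.1 htop
  obtain ⟨Q, hQ, Q', hQ', hlow⟩ := Filter.eventually_prod_iff.1 hlow
  obtain ⟨δ, hδ, hδP⟩ := Metric.eventually_nhds_iff.1 hP'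
  obtain ⟨r, hr, hrQ⟩ := Metric.eventually_nhds_iff.1 hQ'
  refine ⟨r, hr, δ⁻¹, ?_⟩
  filter_upwards [hP, hQ] with t htP htQ x hx hzero
  have hx0 : ‖x‖ ≠ 0 := norm_ne_zero_iff.2 hx
  have hxpos : 0 < ‖x‖ := norm_pos_iff.2 hx
  have hxc : ((‖x‖ : ℝ) : ℂ) ≠ 0 := Complex.ofReal_ne_zero.2 hx0
  set u : Fin n → ℂ := ((‖x‖ : ℝ) : ℂ)⁻¹ • x with hu
  have hxu : x = ((‖x‖ : ℝ) : ℂ) • u := by rw [hu, smul_smul, mul_inv_cancel₀ hxc, one_smul]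
  have hus : u ∈ Metric.sphere (0 : Fin n → ℂ) 1 := by
    rw [mem_sphere_zero_iff_norm, hu, norm_smul, norm_inv, Complex.norm_real, norm_norm,
      inv_mul_cancel₀ hx0]
  constructor
  · by_contra! hlt
    refine hlow htQ (hrQ (y := ((‖x‖ : ℝ) : ℂ)) (by simpa using hlt)) u hus ?_
    funext i
    have h := hzero i
    rw [eval_add_C_mul_eq_sum hf.hasDegrees hg] at h
    have hpow : ((‖x‖ : ℝ) : ℂ) ^ a i ≠ 0 := pow_ne_zero _ hxc
    refine (mul_eq_zero.1 ?_).resolve_left hpow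
    rw [← h, Finset.mul_sum]
    refine Finset.sum_congr rfl fun m _ => ?_
    have hm := (Finset.mem_Icc.1 m.2).1
    have h1 : ∏ l, x l ^ m.1 l = ((‖x‖ : ℝ) : ℂ) ^ m.1.degree * ∏ l, u l ^ m.1 l := by
      conv_lhs => rw [hxu]
      exact prod_smul_pow _ _ _
    have h2 : ((‖x‖ : ℝ) : ℂ) ^ m.1.degree = ((‖x‖ : ℝ) : ℂ) ^ a i *
        ((‖x‖ : ℝ) : ℂ) ^ (m.1.degree - a i) := by rw [← pow_add, Nat.add_sub_cancel' hm]
    rw [h1, h2]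
    ring
  · by_contra! hlt
    have hlt' : ‖x‖⁻¹ < δ := by
      rw [inv_lt_comm₀ hxpos hδ]
      exact hlt
    refine htop htP (hδP (y := ((‖x‖ : ℝ) : ℂ)⁻¹) (by simpa using hlt')) u hus ?_
    funext i
    have h := hzero i
    rw [eval_add_C_mul_eq_sum hf.hasDegrees hg] at h
    have h0 : (((‖x‖ : ℝ) : ℂ)⁻¹) ^ b i * ∑ m : {m : Fin n →₀ ℕ // m.degree ∈ Finset.Icc (a i) (b i)},
      (coeff m.1 (f i) + t * coeff m.1 (g i)) * ∏ l, x l ^ m.1 l = 0 := by rw [h, mul_zero]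
    rw [Pi.zero_apply, ← h0, Finset.mul_sum]
    refine Finset.sum_congr rfl fun m _ => ?_
    have hm := (Finset.mem_Icc.1 m.2).2
    have h1 : ∏ l, u l ^ m.1 l = (((‖x‖ : ℝ) : ℂ)⁻¹) ^ m.1.degree * ∏ l, x l ^ m.1 l :=
      prod_smul_pow _ _ _
    have h2 : (((‖x‖ : ℝ) : ℂ)⁻¹) ^ b i = (((‖x‖ : ℝ) : ℂ)⁻¹) ^ (b i - m.1.degree) *
        (((‖x‖ : ℝ) : ℂ)⁻¹) ^ m.1.degree := by rw [← pow_add, Nat.sub_add_cancel hm]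
    rw [h1, h2]
    ring

theorem IsRegularSystem.eventually_ncard_eq {n : ℕ} {a b : Fin n → ℕ}
    {f : Fin n → MvPolynomial (Fin n) ℂ} (hf : IsRegularSystem a b f)
    {g : Fin n → MvPolynomial (Fin n) ℂ}
    (hg : HasDegrees (fun i => Finset.Icc (a i) (b i)) g) :
    ∀ᶠ t in 𝓝 (0 : ℂ), (puncturedZeros fun i => f i + C t * g i).ncard =
      (puncturedZeros f).ncard := by
  set F : ℂ → (Fin n → ℂ) → (Fin n → ℂ) := fun t x i => eval x (f i) + t * eval x (g i) with hF
  have hset : ∀ t, (puncturedZeros fun i => f i + C t * g i) =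
      {x | x ∈ ({0}ᶜ : Set (Fin n → ℂ)) ∧ F t x = 0} := by
    intro t
    ext x
    simp [puncturedZeros, hF, funext_iff]
  have hset0 : puncturedZeros f = {x | x ∈ ({0}ᶜ : Set (Fin n → ℂ)) ∧ F 0 x = 0} := by
    ext x
    simp [puncturedZeros, hF, funext_iff]
  obtain ⟨r, hr, R, hann⟩ := hf.exists_annulus hg
  simp only [hset, hset0]
  refine (ncard_zeros_eventually_eq (K := Metric.closedBall 0 R \ Metric.ball 0 r) ?_
    ((isCompact_closedBall _ _).diff Metric.isOpen_ball) isOpen_compl_singleton ?_ ?_ ?_).2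
  · have hp : ∀ p : MvPolynomial (Fin n) ℂ, Continuous fun x : Fin n → ℂ => eval x p :=
      fun p => MvPolynomial.continuous_eval p
    refine continuous_pi fun i => ?_
    exact ((hp _).comp continuous_snd).add (continuous_fst.mul ((hp _).comp continuous_snd))
  · rintro x ⟨-, hx⟩ rfl
    exact hx (Metric.mem_ball_self hr)
  · filter_upwards [hann] with t ht x hx
    obtain ⟨h1, h2⟩ := ht x hx.1 (fun i => congrFun hx.2 i)
    simp [h1, h2]
  · intro x hx h0
    refine hf.nondegenerate.exists_nhds_existsUnique_zero g hx fun i => ?_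
    simpa [hF] using congrFun h0 i

/-- The system with prescribed coefficients. -/
noncomputable def systemOfCoeff {n : ℕ} (A : Fin n → Finset ℕ) (c : SystemIndex n A → ℂ)
    (i : Fin n) : MvPolynomial (Fin n) ℂ :=
  letI := Fintype.ofFinite {m : Fin n →₀ ℕ // m.degree ∈ A i}
  ∑ m : {m : Fin n →₀ ℕ // m.degree ∈ A i}, monomial m.1 (c ⟨i, m⟩)

theorem coeff_systemOfCoeff {n : ℕ} (A : Fin n → Finset ℕ) (c : SystemIndex n A → ℂ)
    (i : Fin n) (m : Fin n →₀ ℕ) :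
    coeff m (systemOfCoeff A c i) = if h : m.degree ∈ A i then c ⟨i, m, h⟩ else 0 := by
  classical
  let := Fintype.ofFinite {m : Fin n →₀ ℕ // m.degree ∈ A i}
  simp only [systemOfCoeff, coeff_sum, coeff_monomial]
  split_ifs with h
  · rw [Finset.sum_eq_single ⟨m, h⟩]
    · simp
    · rintro ⟨m', h'⟩ _ hne
      exact if_neg fun e => hne (Subtype.ext e)
    · exact fun h => absurd (Finset.mem_univ _) h
  · refine Finset.sum_eq_zero fun m' _ => if_neg ?_
    rintro rfl
    exact h m'.2

theorem hasDegrees_systemOfCoeff {n : ℕ} (A : Fin n → Finset ℕ) (c : SystemIndex n A → ℂ) :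
    HasDegrees A (systemOfCoeff A c) := by
  intro i m hm
  rw [coeff_systemOfCoeff] at hm
  split_ifs at hm with h
  · exact h
  · exact absurd rfl hm

theorem systemCoeff_systemOfCoeff {n : ℕ} (A : Fin n → Finset ℕ) (c : SystemIndex n A → ℂ) :
    systemCoeff A (systemOfCoeff A c) = c := by
  funext ⟨i, m, h⟩
  simp only [systemCoeff]
  rw [coeff_systemOfCoeff, dif_pos h]

theorem HasDegrees.add_C_mul {n : ℕ} {A : Fin n → Finset ℕ} {f g : Fin n → MvPolynomial (Fin n) ℂ}
    (hf : HasDegrees A f) (hg : HasDegrees A g) (t : ℂ) :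
    HasDegrees A fun i => f i + C t * g i := by
  intro i m hm
  by_contra h
  have h1 : coeff m (f i) = 0 := by
    by_contra h2
    exact h (hf i m h2)
  have h2 : coeff m (g i) = 0 := by
    by_contra h2
    exact h (hg i m h2)
  simp [h1, h2] at hm

theorem isPreconnected_of_countable_compl {T : Set ℂ} (hT : Tᶜ.Countable) :
    IsPreconnected T := by
  have hrank : 1 < Module.rank ℝ ℂ := by
    rw [Complex.rank_real_complex]
    exact_mod_cast one_lt_two
  have h := (hT.isConnected_compl_of_one_lt_rank hrank).isPreconnected
  rwa [compl_compl] at h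

theorem ncard_eq_of_line {n : ℕ} {a b : Fin n → ℕ} {f g : Fin n → MvPolynomial (Fin n) ℂ}
    (hg : HasDegrees (fun i => Finset.Icc (a i) (b i)) g) {T : Set ℂ} (hT : Tᶜ.Countable)
    (hreg : ∀ t ∈ T, IsRegularSystem a b fun i => f i + C t * g i) {s t : ℂ} (hs : s ∈ T)
    (ht : t ∈ T) : (puncturedZeros fun i => f i + C s * g i).ncard =
      (puncturedZeros fun i => f i + C t * g i).ncard := by
  have hconn : IsPreconnected T := isPreconnected_of_countable_compl hT
  have hcont : ContinuousOn (fun t : ℂ => (puncturedZeros fun i => f i + C t * g i).ncard) T := by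
    intro t₀ ht₀
    refine ContinuousAt.continuousWithinAt ?_
    have h := (hreg t₀ ht₀).eventually_ncard_eq hg
    have hlim : Tendsto (fun t : ℂ => t - t₀) (𝓝 t₀) (𝓝 0) := by
      have : Continuous fun t : ℂ => t - t₀ := by fun_prop
      simpa using this.tendsto t₀
    refine (continuousAt_const (y := (puncturedZeros fun i => f i + C t₀ * g i).ncard)).congr ?_
    filter_upwards [hlim.eventually h] with t ht
    have hfun : (fun i => f i + C t₀ * g i + C (t - t₀) * g i) = fun i => f i + C t * g i := by
      funext i
      rw [add_assoc, ← add_mul, ← C_add, add_sub_cancel]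
    rw [hfun] at ht
    exact ht.symm
  exact hconn.constant_of_mapsTo (isDiscrete_univ_iff.2 inferInstance) hcont (Set.mapsTo_univ _ _) hs ht

theorem IsRegularSystem.ncard_eq {n : ℕ} {a b : Fin n → ℕ} (hab : ∀ i, a i ≤ b i)
    {f₀ f₁ : Fin n → MvPolynomial (Fin n) ℂ} (h₀ : IsRegularSystem a b f₀)
    (h₁ : IsRegularSystem a b f₁) :
    (puncturedZeros f₀).ncard = (puncturedZeros f₁).ncard := by
  set A : Fin n → Finset ℕ := fun i => Finset.Icc (a i) (b i) with hA
  have hne : ∀ i, (A i).Nonempty := fun i => Finset.nonempty_Icc.2 (hab i)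
  obtain ⟨q, hq0, hq⟩ := exists_hypersurface_not_regular hne
  have hmin : (fun i => (A i).min' (hne i)) = a := by
    funext i
    refine le_antisymm (Finset.min'_le _ _ (Finset.left_mem_Icc.2 (hab i))) ?_
    exact (Finset.mem_Icc.1 ((A i).min'_mem (hne i))).1
  have hmax : (fun i => (A i).max' (hne i)) = b := by
    funext i
    refine le_antisymm ?_ (Finset.le_max' _ _ (Finset.right_mem_Icc.2 (hab i)))
    exact (Finset.mem_Icc.1 ((A i).max'_mem (hne i))).2
  rw [hmin, hmax] at hq
  obtain ⟨c, hc⟩ : ∃ c, eval c q ≠ 0 := by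
    by_contra! h
    exact hq0 (MvPolynomial.funext fun c => by rw [h c, map_zero])
  set f' := systemOfCoeff A c with hf'
  have hf'c : systemCoeff A f' = c := systemCoeff_systemOfCoeff A c
  have hf'd : HasDegrees A f' := hasDegrees_systemOfCoeff A c
  have hf'r : IsRegularSystem a b f' := hq f' hf'd (by rwa [hf'c])
  have key : ∀ f : Fin n → MvPolynomial (Fin n) ℂ, IsRegularSystem a b f →
      (puncturedZeros f).ncard = (puncturedZeros f').ncard := by
    intro f hf
    set g : Fin n → MvPolynomial (Fin n) ℂ := fun i => f' i + C (-1) * f i with hg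
    have hgd : HasDegrees A g := hf'd.add_C_mul hf.hasDegrees (-1)
    set P : Polynomial ℂ := aeval (fun p => Polynomial.C (systemCoeff A f p) +
      Polynomial.X * Polynomial.C (systemCoeff A g p)) q with hP
    have hPe : ∀ t, P.eval t = eval (systemCoeff A fun i => f i + C t * g i) q := by
      intro t
      rw [← Polynomial.coe_aeval_eq_eval, hP, ← AlgHom.comp_apply, comp_aeval,
        ← coe_aeval_eq_eval]
      change aeval _ q = aeval _ q
      congr 2
      funext p
      simp [systemCoeff]
      ring
    have h1 : ∀ i, f i + C (1 : ℂ) * g i = f' i := by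
      intro i
      simp only [hg, C_1, C_neg]
      ring
    have h0 : ∀ i, f i + C (0 : ℂ) * g i = f i := by
      intro i
      simp
    have hP0 : P ≠ 0 := by
      intro h
      have := hPe 1
      simp only [h1] at this
      rw [h, Polynomial.eval_zero] at this
      exact hc (by rw [← hf'c]; exact this.symm)
    have := ncard_eq_of_line (f := f) (T := {t | P.eval t ≠ 0} ∪ {0}) hgd ?_ ?_
      (s := 0) (t := 1) (Or.inr rfl) (Or.inl ?_)
    · simpa only [h0, h1] using this
    · refine ((P.roots.toFinset.finite_toSet).subset fun t ht => ?_).countable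
      have : P.eval t = 0 := by
        by_contra h
        exact ht (Or.inl h)
      simpa [hP0] using this
    · rintro t (ht | rfl)
      · refine hq _ (hf.hasDegrees.add_C_mul hgd t) ?_
        rw [← hPe]
        exact ht
      · simpa only [h0] using hf
    · change P.eval 1 ≠ 0
      rw [hPe]
      simpa only [h1, hf'c] using hc
  rw [key f₀ h₀, key f₁ h₁]

end PersistenceOfZeros

theorem homogeneousComponent_prod_sub_C {σ ι : Type*} [Fintype ι] [DecidableEq ι]
    {L : ι → MvPolynomial σ ℂ} (hL : ∀ j, (L j).IsHomogeneous 1) (c : ι → ℂ) (d : ℕ) :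
    homogeneousComponent d (∏ j, (L j - C (c j))) =
      ∑ S : Finset ι, if d = S.card then (∏ j ∈ S, L j) * ∏ j ∈ Sᶜ, C (-c j) else 0 := by
  have h1 : ∏ j, (L j - C (c j)) = ∑ S : Finset ι, (∏ j ∈ S, L j) * ∏ j ∈ Sᶜ, C (-c j) := by
    simp only [sub_eq_add_neg, ← C_neg]
    exact Fintype.prod_add _ _
  rw [h1, map_sum]
  refine Finset.sum_congr rfl fun S _ => homogeneousComponent_of_mem ?_
  have h2 := (IsHomogeneous.prod S L (fun _ => 1) fun j _ => hL j).mul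
    (IsHomogeneous.prod Sᶜ (fun j => (C (-c j) : MvPolynomial σ ℂ)) (fun _ => 0)
      fun j _ => isHomogeneous_C _ _)
  simpa using h2

theorem prod_sub_C_degree_mem {σ ι : Type*} [Fintype ι] [DecidableEq ι]
    {L : ι → MvPolynomial σ ℂ} (hL : ∀ j, (L j).IsHomogeneous 1) {c : ι → ℂ} {H : Finset ι}
    (hc : ∀ j ∈ H, c j = 0) {m : σ →₀ ℕ} (hm : coeff m (∏ j, (L j - C (c j))) ≠ 0) :
    H.card ≤ m.degree ∧ m.degree ≤ Fintype.card ι := by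
  have h1 : coeff m (homogeneousComponent m.degree (∏ j, (L j - C (c j)))) ≠ 0 := by
    rwa [coeff_homogeneousComponent, if_pos rfl]
  rw [homogeneousComponent_prod_sub_C hL, coeff_sum] at h1
  obtain ⟨S, -, hS⟩ := Finset.exists_ne_zero_of_sum_ne_zero h1
  split_ifs at hS with hd
  · rw [hd]
    refine ⟨Finset.card_le_card fun j hj => ?_, Finset.card_le_univ _⟩
    by_contra hjS
    refine hS ?_
    rw [Finset.prod_eq_zero (Finset.mem_compl.2 hjS) (by rw [hc j hj, neg_zero, C_0]), mul_zero,
      coeff_zero]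
  · exact absurd (coeff_zero _) hS

theorem homogeneousComponent_card_prod_sub_C {σ ι : Type*} [Fintype ι]
    {L : ι → MvPolynomial σ ℂ} (hL : ∀ j, (L j).IsHomogeneous 1) (c : ι → ℂ) :
    homogeneousComponent (Fintype.card ι) (∏ j, (L j - C (c j))) = ∏ j, L j := by
  classical
  rw [homogeneousComponent_prod_sub_C hL, Finset.sum_eq_single Finset.univ]
  · simp
  · intro S _ hS
    exact if_neg fun h => hS (Finset.card_eq_iff_eq_univ S |>.1 h.symm)
  · exact fun h => absurd (Finset.mem_univ _) h

theorem homogeneousComponent_card_zero_prod_sub_C {σ ι : Type*} [Fintype ι] [DecidableEq ι]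
    {L : ι → MvPolynomial σ ℂ} (hL : ∀ j, (L j).IsHomogeneous 1) {c : ι → ℂ} {H : Finset ι}
    (hc : ∀ j ∈ H, c j = 0) :
    homogeneousComponent H.card (∏ j, (L j - C (c j))) =
      (∏ j ∈ H, L j) * ∏ j ∈ Hᶜ, C (-c j) := by
  rw [homogeneousComponent_prod_sub_C hL, Finset.sum_eq_single H]
  · simp
  · intro S _ hS
    split_ifs with h
    · have : ¬ H ⊆ S := fun hHS => hS (Finset.eq_of_subset_of_card_le hHS h.ge).symm
      obtain ⟨j, hj, hjS⟩ := Finset.not_subset.1 this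
      rw [Finset.prod_eq_zero (Finset.mem_compl.2 hjS) (by rw [hc j hj, neg_zero, C_0]), mul_zero]
    · rfl
  · exact fun h => absurd (Finset.mem_univ _) h

/-- Any number of linear forms in general position. -/
theorem exists_linear_forms_general_position (n : ℕ) (κ : Type*) [Finite κ] :
    ∃ l : κ → Fin n → ℂ, ∀ σ : Fin n → κ, Function.Injective σ →
      ∀ x, (∀ j, l (σ j) ⬝ᵥ x = 0) → x = 0 := by
  obtain ⟨N, ⟨e⟩⟩ := Finite.exists_equiv_fin κ
  refine ⟨fun k r => ((e k : ℕ) : ℂ) ^ (r : ℕ), fun σ hσ x hx => ?_⟩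
  have hdet : (Matrix.vandermonde fun j => ((e (σ j) : ℕ) : ℂ)).det ≠ 0 := by
    rw [Matrix.det_vandermonde_ne_zero_iff]
    intro i j hij
    exact hσ (e.injective (Fin.ext (Nat.cast_injective hij)))
  exact Matrix.eq_zero_of_mulVec_eq_zero hdet (funext hx)

/-- Affine hyperplanes in general position, with a prescribed set of linear ones. -/
theorem exists_hyperplanes_general_position (n : ℕ) (κ : Type*) [Finite κ] (H : Set κ) :
    ∃ (l : κ → Fin n → ℂ) (c : κ → ℂ),
      (∀ σ : Fin n → κ, Function.Injective σ → ∀ x, (∀ j, l (σ j) ⬝ᵥ x = 0) → x = 0) ∧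
      (∀ k, c k = 0 ↔ k ∈ H) ∧
      ∀ σ : Fin (n + 1) → κ, Function.Injective σ → ∀ x, (∀ j, l (σ j) ⬝ᵥ x = c (σ j)) →
        x = 0 := by
  classical
  obtain ⟨l, hl⟩ := exists_linear_forms_general_position n κ
  let E : ({k // k ∉ H} → ℂ) →ₗ[ℂ] (κ → ℂ) :=
    { toFun := fun c k => if h : k ∈ H then 0 else c ⟨k, h⟩
      map_add' := fun c d => by
        ext k
        by_cases h : k ∈ H <;> simp [h]
      map_smul' := fun r c => by
        ext k
        by_cases h : k ∈ H <;> simp [h] }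
  have hE : ∀ c k, k ∈ H → E c k = 0 := fun c k h => dif_pos h
  let W : (Fin (n + 1) → κ) → Submodule ℂ ({k // k ∉ H} → ℂ) := fun σ =>
    (LinearMap.range (Matrix.mulVecLin (Matrix.of fun j => l (σ j)))).comap
      (LinearMap.funLeft ℂ ℂ σ ∘ₗ E)
  let Z : κ → Submodule ℂ ({k // k ∉ H} → ℂ) := fun k =>
    LinearMap.ker (LinearMap.proj (R := ℂ) (φ := fun _ : κ => ℂ) k ∘ₗ E)
  let s : Set (Submodule ℂ ({k // k ∉ H} → ℂ)) :=
    (W '' {σ | Function.Injective σ ∧ ∃ j, σ j ∉ H}) ∪ Z '' Hᶜ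
  have hs : s.Finite := ((Set.toFinite _).image W).union ((Set.toFinite _).image Z)
  have htop : ⊤ ∉ hs.toFinset := by
    rw [Set.Finite.mem_toFinset]
    rintro (⟨σ, ⟨hσ, j, hj⟩, h⟩ | ⟨k, hk, h⟩)
    · have h1 : Pi.single ⟨σ j, hj⟩ 1 ∈ W σ := h ▸ Submodule.mem_top
      obtain ⟨x, hx⟩ := h1
      have hx' : ∀ i, l (σ i) ⬝ᵥ x = E (Pi.single ⟨σ j, hj⟩ 1) (σ i) := fun i => congrFun hx i
      have h0 : x = 0 := by
        refine hl (σ ∘ j.succAbove) (hσ.comp j.succAbove_right_injective) x fun i => ?_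
        refine (hx' (j.succAbove i)).trans ?_
        by_cases hH : σ (j.succAbove i) ∈ H
        · exact hE _ _ hH
        · have hne : σ (j.succAbove i) ≠ σ j := fun e => j.succAbove_ne i (hσ e)
          simp [E, hH, hne]
      have := hx' j
      simp [h0, E, hj] at this
    · have h1 : Pi.single ⟨k, hk⟩ 1 ∈ Z k := h ▸ Submodule.mem_top
      have hk' : k ∉ H := hk
      simp [Z, E, hk'] at h1
  have hne := Subspace.biUnion_ne_univ_of_top_notMem htop
  obtain ⟨c, hc⟩ := (Set.ne_univ_iff_exists_notMem _).1 hne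
  simp only [Set.mem_iUnion, not_exists, Set.Finite.mem_toFinset] at hc
  refine ⟨l, E c, hl, fun k => ⟨fun h => ?_, hE c k⟩, fun σ hσ x hx => ?_⟩
  · by_contra hk
    exact hc (Z k) (Or.inr ⟨k, hk, rfl⟩) h
  · by_cases h : ∃ j, σ j ∉ H
    · exact absurd ⟨x, funext hx⟩ (hc (W σ) (Or.inl ⟨σ, ⟨hσ, h⟩, rfl⟩))
    · push Not at h
      refine hl (σ ∘ Fin.castSucc) (hσ.comp (Fin.castSucc_injective n)) x fun j => ?_
      exact (hx _).trans (hE c _ (h _))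

/-- The linear form with coefficient vector `v`. -/
noncomputable def linearForm {n : ℕ} (v : Fin n → ℂ) : MvPolynomial (Fin n) ℂ :=
  ∑ r, C (v r) * X r

theorem isHomogeneous_linearForm {n : ℕ} (v : Fin n → ℂ) : (linearForm v).IsHomogeneous 1 :=
  IsHomogeneous.sum _ _ _ fun r _ => isHomogeneous_C_mul_X (v r) r

@[simp] theorem eval_linearForm {n : ℕ} (v x : Fin n → ℂ) : eval x (linearForm v) = v ⬝ᵥ x := by
  simp [linearForm, dotProduct]

theorem fst_aeval_linearForm {n : ℕ} (v : Fin n → ℂ) (Y : Fin n → DualNumber ℂ) :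
    (aeval Y (linearForm v)).fst = v ⬝ᵥ fun j => (Y j).fst := by
  simp [linearForm, dotProduct, TrivSqZeroExt.fst_sum, TrivSqZeroExt.algebraMap_eq_inl]

theorem snd_aeval_linearForm {n : ℕ} (v : Fin n → ℂ) (Y : Fin n → DualNumber ℂ) :
    (aeval Y (linearForm v)).snd = v ⬝ᵥ fun j => (Y j).snd := by
  simp [linearForm, dotProduct, TrivSqZeroExt.snd_sum, TrivSqZeroExt.algebraMap_eq_inl]

/-- The system whose `i`-th polynomial is the product of the affine forms
`l ⟨i, j⟩ ⬝ᵥ x - c ⟨i, j⟩`. -/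
noncomputable def productSystem {n : ℕ} {b : Fin n → ℕ} (l : (Σ i, Fin (b i)) → Fin n → ℂ)
    (c : (Σ i, Fin (b i)) → ℂ) (i : Fin n) : MvPolynomial (Fin n) ℂ :=
  ∏ j, (linearForm (l ⟨i, j⟩) - C (c ⟨i, j⟩))

theorem eval_productSystem_eq_zero {n : ℕ} {b : Fin n → ℕ} {l : (Σ i, Fin (b i)) → Fin n → ℂ}
    {c : (Σ i, Fin (b i)) → ℂ} {x : Fin n → ℂ} {i : Fin n} :
    eval x (productSystem l c i) = 0 ↔ ∃ j, l ⟨i, j⟩ ⬝ᵥ x = c ⟨i, j⟩ := by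
  simp [productSystem, Finset.prod_eq_zero_iff, sub_eq_zero]

theorem injective_sigma_choice {n : ℕ} {b : Fin n → ℕ} (σ : ∀ i, Fin (b i)) :
    Function.Injective fun i => (⟨i, σ i⟩ : Σ i, Fin (b i)) :=
  fun _ _ h => congrArg Sigma.fst h

/-- At most one affine form of each factor vanishes at a zero of a product system in general
position. -/
theorem eq_of_productSystem_factors_eq_zero {n : ℕ} {b : Fin n → ℕ}
    {l : (Σ i, Fin (b i)) → Fin n → ℂ} {c : (Σ i, Fin (b i)) → ℂ}
    (hc : ∀ σ : Fin (n + 1) → Σ i, Fin (b i), Function.Injective σ → ∀ x,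
      (∀ j, l (σ j) ⬝ᵥ x = c (σ j)) → x = 0)
    {x : Fin n → ℂ} (hx : x ≠ 0) {σ : ∀ i, Fin (b i)}
    (hσ : ∀ i, l ⟨i, σ i⟩ ⬝ᵥ x = c ⟨i, σ i⟩) {i : Fin n} {j : Fin (b i)}
    (hj : l ⟨i, j⟩ ⬝ᵥ x = c ⟨i, j⟩) : j = σ i := by
  by_contra hne
  refine hx (hc (Fin.cons ⟨i, j⟩ fun i => ⟨i, σ i⟩) ?_ x fun k => ?_)
  · refine Fin.cons_injective_iff.2 ⟨?_, injective_sigma_choice σ⟩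
    rintro ⟨i', h⟩
    obtain rfl : i' = i := congrArg Sigma.fst h
    exact hne (eq_of_heq (Sigma.mk.inj h).2).symm
  · refine Fin.cases ?_ (fun k => ?_) k
    · simpa using hj
    · simpa using hσ k

theorem isRegularSystem_productSystem {n : ℕ} {a b : Fin n → ℕ} (hab : ∀ i, a i ≤ b i)
    {l : (Σ i, Fin (b i)) → Fin n → ℂ} {c : (Σ i, Fin (b i)) → ℂ}
    (hl : ∀ σ : Fin n → Σ i, Fin (b i), Function.Injective σ → ∀ x,
      (∀ j, l (σ j) ⬝ᵥ x = 0) → x = 0)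
    (hc0 : ∀ k, c k = 0 ↔ (k.2 : ℕ) < a k.1)
    (hc : ∀ σ : Fin (n + 1) → Σ i, Fin (b i), Function.Injective σ → ∀ x,
      (∀ j, l (σ j) ⬝ᵥ x = c (σ j)) → x = 0) :
    IsRegularSystem a b (productSystem l c) := by
  classical
  have hH : ∀ i, (Finset.univ.filter fun j : Fin (b i) => (j : ℕ) < a i).card = a i := fun i => by
    rw [Fin.card_filter_val_lt, min_eq_right (hab i)]
  have hhom : ∀ i j, (linearForm (l ⟨i, j⟩)).IsHomogeneous 1 :=
    fun i j => isHomogeneous_linearForm _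
  have hcH : ∀ i, ∀ j ∈ Finset.univ.filter fun j : Fin (b i) => (j : ℕ) < a i, c ⟨i, j⟩ = 0 :=
    fun i j hj => (hc0 ⟨i, j⟩).2 (Finset.mem_filter.1 hj).2
  refine ⟨fun i m hm => ?_, fun x hx => ?_, fun x hx => ?_, fun Y hY hne => ?_⟩
  · have h := prod_sub_C_degree_mem (hhom i) (hcH i) hm
    rw [hH, Fintype.card_fin] at h
    exact Finset.mem_Icc.2 h
  · by_contra! hcon
    have h : ∀ i, ∃ j, l ⟨i, j⟩ ⬝ᵥ x = 0 := fun i => by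
      have h := hcon i
      have h2 := homogeneousComponent_card_prod_sub_C (hhom i) fun j => c ⟨i, j⟩
      rw [Fintype.card_fin] at h2
      rw [productSystem, h2, eval_prod, Finset.prod_eq_zero_iff] at h
      simpa using h
    choose σ hσ using h
    exact hx (hl _ (injective_sigma_choice σ) x hσ)
  · by_contra! hcon
    have h : ∀ i, ∃ j, l ⟨i, j⟩ ⬝ᵥ x = 0 := fun i => by
      have h := hcon i
      have h2 := homogeneousComponent_card_zero_prod_sub_C (hhom i) (hcH i)
      rw [hH] at h2
      rw [productSystem, h2, map_mul, mul_eq_zero, eval_prod, eval_prod,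
        Finset.prod_eq_zero_iff, Finset.prod_eq_zero_iff] at h
      rcases h with ⟨j, -, hj⟩ | ⟨j, hj, hj0⟩
      · exact ⟨j, by simpa using hj⟩
      · refine absurd ?_ (Finset.mem_compl.1 hj)
        refine Finset.mem_filter.2 ⟨Finset.mem_univ _, (hc0 ⟨i, j⟩).1 ?_⟩
        simpa using hj0
    choose σ hσ using h
    exact hx (hl _ (injective_sigma_choice σ) x hσ)
  · set x : Fin n → ℂ := fun j => (Y j).fst with hx
    have hx0 : x ≠ 0 := Function.ne_iff.2 hne
    have hfst : ∀ i j, (aeval Y (linearForm (l ⟨i, j⟩) - C (c ⟨i, j⟩))).fst =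
        l ⟨i, j⟩ ⬝ᵥ x - c ⟨i, j⟩ := fun i j => by
      rw [map_sub, TrivSqZeroExt.fst_sub, fst_aeval_linearForm, algHom_C,
        TrivSqZeroExt.algebraMap_eq_inl, TrivSqZeroExt.fst_inl]
    have hsnd : ∀ i j, (aeval Y (linearForm (l ⟨i, j⟩) - C (c ⟨i, j⟩))).snd =
        l ⟨i, j⟩ ⬝ᵥ fun r => (Y r).snd := fun i j => by
      rw [map_sub, TrivSqZeroExt.snd_sub, snd_aeval_linearForm, algHom_C,
        TrivSqZeroExt.algebraMap_eq_inl, TrivSqZeroExt.snd_inl, sub_zero]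
    have hprod : ∀ i, ∏ j, aeval Y (linearForm (l ⟨i, j⟩) - C (c ⟨i, j⟩)) = 0 := fun i => by
      rw [← map_prod]
      exact hY i
    have h : ∀ i, ∃ j, l ⟨i, j⟩ ⬝ᵥ x = c ⟨i, j⟩ := fun i => by
      by_contra! hcon
      have hunit : IsUnit (∏ j, aeval Y (linearForm (l ⟨i, j⟩) - C (c ⟨i, j⟩))) :=
        IsUnit.prod_iff.2 fun j _ => TrivSqZeroExt.isUnit_iff_isUnit_fst.2 (by
          rw [hfst]
          exact (sub_ne_zero.2 (hcon j)).isUnit)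
      rw [hprod i] at hunit
      exact not_isUnit_zero hunit
    choose σ hσ using h
    have hzero : (fun r => (Y r).snd) = 0 := by
      refine hl _ (injective_sigma_choice σ) _ fun i => ?_
      have hunit : IsUnit (∏ j ∈ Finset.univ.erase (σ i),
          aeval Y (linearForm (l ⟨i, j⟩) - C (c ⟨i, j⟩))) :=
        IsUnit.prod_iff.2 fun j hj => TrivSqZeroExt.isUnit_iff_isUnit_fst.2 (by
          rw [hfst]
          exact (sub_ne_zero.2 fun h => Finset.ne_of_mem_erase hj
            (eq_of_productSystem_factors_eq_zero hc hx0 hσ h)).isUnit)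
      have h := hprod i
      rw [← Finset.mul_prod_erase _ _ (Finset.mem_univ (σ i)), hunit.mul_left_eq_zero] at h
      rw [← hsnd, h, TrivSqZeroExt.snd_zero]
    exact fun j => congrFun hzero j

theorem ncard_puncturedZeros_productSystem {n : ℕ} {a b : Fin n → ℕ} (hab : ∀ i, a i ≤ b i)
    {l : (Σ i, Fin (b i)) → Fin n → ℂ} {c : (Σ i, Fin (b i)) → ℂ}
    (hl : ∀ σ : Fin n → Σ i, Fin (b i), Function.Injective σ → ∀ x,
      (∀ j, l (σ j) ⬝ᵥ x = 0) → x = 0)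
    (hc0 : ∀ k, c k = 0 ↔ (k.2 : ℕ) < a k.1)
    (hc : ∀ σ : Fin (n + 1) → Σ i, Fin (b i), Function.Injective σ → ∀ x,
      (∀ j, l (σ j) ⬝ᵥ x = c (σ j)) → x = 0) :
    (puncturedZeros (productSystem l c)).ncard = ∏ i, b i - ∏ i, a i := by
  classical
  have hex : ∀ σ : ∀ i, Fin (b i), ∃ x, ∀ i, l ⟨i, σ i⟩ ⬝ᵥ x = c ⟨i, σ i⟩ := fun σ => by
    have hinj : Function.Injective (Matrix.mulVecLin (Matrix.of fun i => l ⟨i, σ i⟩)) := by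
      rw [← LinearMap.ker_eq_bot, LinearMap.ker_eq_bot']
      exact fun x hx => hl _ (injective_sigma_choice σ) x fun i => congrFun hx i
    obtain ⟨x, hx⟩ := LinearMap.injective_iff_surjective.1 hinj fun i => c ⟨i, σ i⟩
    exact ⟨x, fun i => congrFun hx i⟩
  choose p hp using hex
  set G : Finset (∀ i, Fin (b i)) :=
    Fintype.piFinset fun i => Finset.univ.filter fun j : Fin (b i) => (j : ℕ) < a i with hG
  have hp0 : ∀ σ, p σ = 0 ↔ σ ∈ G := fun σ => by
    simp only [hG, Fintype.mem_piFinset, Finset.mem_filter, Finset.mem_univ, true_and]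
    constructor
    · intro h i
      rw [← hc0 ⟨i, σ i⟩, ← hp σ i, h, dotProduct_zero]
    · intro h
      refine hl _ (injective_sigma_choice σ) _ fun i => ?_
      rw [hp σ i]
      exact (hc0 ⟨i, σ i⟩).2 (h i)
  have himage : puncturedZeros (productSystem l c) = p '' (Gᶜ : Finset _) := by
    ext x
    constructor
    · rintro ⟨hx, h⟩
      choose σ hσ using fun i => eval_productSystem_eq_zero.1 (h i)
      have hpx : p σ = x := by
        refine sub_eq_zero.1 (hl _ (injective_sigma_choice σ) _ fun i => ?_)
        rw [dotProduct_sub, hp, hσ, sub_self]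
      refine ⟨σ, ?_, hpx⟩
      rw [Finset.mem_coe, Finset.mem_compl, ← hp0, hpx]
      exact hx
    · rintro ⟨σ, hσ, rfl⟩
      rw [Finset.mem_coe, Finset.mem_compl, ← hp0] at hσ
      exact ⟨hσ, fun i => eval_productSystem_eq_zero.2 ⟨σ i, hp σ i⟩⟩
  have hinj : Set.InjOn p (Gᶜ : Finset _) := by
    intro σ hσ τ hτ h
    rw [Finset.mem_coe, Finset.mem_compl, ← hp0] at hσ
    funext i
    refine (eq_of_productSystem_factors_eq_zero hc hσ (hp σ) ?_).symm
    rw [h]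
    exact hp τ i
  rw [himage, hinj.ncard_image, Set.ncard_coe_finset, Finset.card_compl, hG,
    Fintype.card_piFinset, Fintype.card_pi]
  congr 1
  · simp
  · exact Finset.prod_congr rfl fun i _ => by rw [Fin.card_filter_val_lt, min_eq_right (hab i)]

theorem IsRegularSystem.ncard_eq_prod_sub_prod {n : ℕ} {a b : Fin n → ℕ}
    (hab : ∀ i, a i ≤ b i) {f : Fin n → MvPolynomial (Fin n) ℂ} (hf : IsRegularSystem a b f) :
    (puncturedZeros f).ncard = ∏ i, b i - ∏ i, a i := by
  obtain ⟨l, c, hl, hc0, hc⟩ :=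
    exists_hyperplanes_general_position n (Σ i, Fin (b i)) {k | (k.2 : ℕ) < a k.1}
  rw [hf.ncard_eq hab (isRegularSystem_productSystem hab hl hc0 hc)]
  exact ncard_puncturedZeros_productSystem hab hl hc0 hc

theorem sum_neg_one_pow_mul_sum_pow {n : ℕ} (x : Fin n → ℝ) :
    ∑ S : Finset (Fin n), (-1 : ℝ) ^ (n - S.card) * (∑ i ∈ S, x i) ^ n =
      n.factorial * ∏ i, x i := by
  have hpow : ∀ S : Finset (Fin n), (∑ i ∈ S, x i) ^ n =
      ∑ p : Fin n → Fin n, if ∀ k, p k ∈ S then ∏ k, x (p k) else 0 := fun S => by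
    have h := Finset.prod_univ_sum (fun _ : Fin n => S) fun _ i => x i
    rw [Finset.prod_const, Finset.card_univ, Fintype.card_fin] at h
    rw [h, ← Finset.sum_filter]
    refine Finset.sum_congr ?_ fun _ _ => rfl
    ext p
    simp
  have hsign : ∀ p : Fin n → Fin n,
      (∑ S : Finset (Fin n), if ∀ k, p k ∈ S then (-1 : ℝ) ^ (n - S.card) else 0) =
        if Function.Bijective p then 1 else 0 := fun p => by
    have h := Finset.sum_powerset_neg_one_pow_card (x := (Finset.univ.image p)ᶜ)
    have h1 : (∑ S : Finset (Fin n), if ∀ k, p k ∈ S then (-1 : ℝ) ^ (n - S.card) else 0) =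
        ∑ S : Finset (Fin n), if ∀ k, p k ∈ Sᶜ then (-1 : ℝ) ^ S.card else 0 := by
      refine Fintype.sum_equiv (compl_involutive (α := Finset (Fin n))).toPerm _ _ fun S => ?_
      simp [Finset.card_compl]
    rw [h1, ← Finset.sum_filter]
    have h2 : (Finset.univ.filter fun S : Finset (Fin n) => ∀ k, p k ∈ Sᶜ) =
        (Finset.univ.image p)ᶜ.powerset := by
      ext S
      simp only [Finset.mem_filter, Finset.mem_univ, true_and, Finset.mem_compl,
        Finset.mem_powerset, Finset.subset_iff, Finset.mem_image, not_exists]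
      exact ⟨fun h i hi k hk => h k (hk ▸ hi), fun h k hk => h hk k rfl⟩
    have h3 : (Finset.univ.image p)ᶜ = ∅ ↔ Function.Bijective p := by
      rw [Finset.compl_eq_empty_iff, ← Finset.coe_eq_univ, Finset.coe_image, Finset.coe_univ,
        Set.image_univ, Set.range_eq_univ, Finite.surjective_iff_bijective]
    rw [h2]
    simp only [h3] at h
    exact_mod_cast congrArg (Int.cast : ℤ → ℝ) h
  calc ∑ S : Finset (Fin n), (-1 : ℝ) ^ (n - S.card) * (∑ i ∈ S, x i) ^ n
      = ∑ p : Fin n → Fin n, (∏ k, x (p k)) *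
          ∑ S : Finset (Fin n), if ∀ k, p k ∈ S then (-1 : ℝ) ^ (n - S.card) else 0 := by
        simp only [hpow, Finset.mul_sum]
        rw [Finset.sum_comm]
        refine Finset.sum_congr rfl fun p _ => Finset.sum_congr rfl fun S _ => ?_
        split_ifs <;> ring
    _ = ∑ p ∈ Finset.univ.filter (Function.Bijective : (Fin n → Fin n) → Prop),
          ∏ k, x (p k) := by
        simp only [hsign, mul_ite, mul_one, mul_zero, Finset.sum_filter]
    _ = ∑ _σ : Equiv.Perm (Fin n), ∏ k, x k :=
        Finset.sum_bij (fun p hp => Equiv.ofBijective p (Finset.mem_filter.1 hp).2)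
          (fun _ _ => Finset.mem_univ _)
          (fun _ _ _ _ h => congrArg (fun σ : Equiv.Perm (Fin n) => (σ : Fin n → Fin n)) h)
          (fun σ _ => ⟨σ, Finset.mem_filter.2 ⟨Finset.mem_univ _, σ.bijective⟩,
            Equiv.ext fun _ => rfl⟩)
          (fun p hp => (Equiv.ofBijective p (Finset.mem_filter.1 hp).2).prod_comp x)
    _ = n.factorial * ∏ i, x i := by
        rw [Finset.sum_const, Finset.card_univ, Fintype.card_perm, Fintype.card_fin, nsmul_eq_mul]

theorem factorial_mul_mixedIntegralPhi (n : ℕ) (a b : Fin n → ℝ) :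
    n.factorial * mixedIntegralPhi n a b = ∏ i, b i - ∏ i, a i := by
  have hn : (n.factorial : ℝ) ≠ 0 := Nat.cast_ne_zero.2 n.factorial_ne_zero
  rw [mixedIntegralPhi, ← mul_assoc, mul_one_div_cancel hn, one_mul]
  have h : ∀ S : Finset (Fin n),
      (-1 : ℝ) ^ (n - S.card) * (((∑ i ∈ S, b i) ^ n - (∑ i ∈ S, a i) ^ n) / n.factorial) =
        ((-1 : ℝ) ^ (n - S.card) * (∑ i ∈ S, b i) ^ n -
          (-1 : ℝ) ^ (n - S.card) * (∑ i ∈ S, a i) ^ n) / n.factorial := fun S => by ring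
  simp only [h]
  rw [← Finset.sum_div, Finset.sum_sub_distrib, sum_neg_one_pow_mul_sum_pow,
    sum_neg_one_pow_mul_sum_pow, ← mul_sub, mul_div_cancel_left₀ _ hn]

theorem mem_degSpace {n : ℕ} {A : Finset ℕ} {p : MvPolynomial (Fin n) ℂ} :
    p ∈ degSpace n A ↔ ∀ m, coeff m p ≠ 0 → m.degree ∈ A := by
  constructor
  · intro hp m hm
    have hle : degSpace n A ≤ restrictSupport ℂ {m : Fin n →₀ ℕ | m.degree ∈ A} := by
      refine iSup₂_le fun k hk q hq => ?_
      rw [mem_restrictSupport_iff]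
      intro m hm
      have h : m.degree = k := (DFunLike.congr_fun Finsupp.degree_eq_weight_one m).trans
        ((mem_homogeneousSubmodule k q).1 hq (mem_support_iff.1 hm))
      exact Set.mem_ofPred.2 (h ▸ hk)
    exact (mem_restrictSupport_iff _).1 (hle hp) (mem_support_iff.2 hm)
  · intro h
    rw [p.as_sum]
    refine Submodule.sum_mem _ fun m hm => ?_
    exact Submodule.mem_iSup_of_mem m.degree (Submodule.mem_iSup_of_mem
      (h m (mem_support_iff.1 hm)) (isHomogeneous_monomial _ rfl))

/-- The coefficients as linear coordinates on the space of systems. -/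
noncomputable def systemEquiv {n : ℕ} (A : Fin n → Finset ℕ) :
    (Π i : Fin n, ↥(degSpace n (A i))) ≃ₗ[ℂ] (SystemIndex n A → ℂ) where
  toFun f := systemCoeff A fun i => f i
  map_add' f g := by
    ext p
    simp [systemCoeff]
  map_smul' r f := by
    ext p
    simp [systemCoeff]
  invFun c i := ⟨systemOfCoeff A c i, mem_degSpace.2 fun m => hasDegrees_systemOfCoeff A c i m⟩
  left_inv f := by
    funext i
    refine Subtype.ext (MvPolynomial.ext _ _ fun m => ?_)
    change coeff m (systemOfCoeff A _ i) = _
    rw [coeff_systemOfCoeff]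
    split_ifs with h
    · rfl
    · by_contra h0
      exact h (mem_degSpace.1 (f i).2 m (Ne.symm h0))
  right_inv c := systemCoeff_systemOfCoeff A c

theorem isGenericSubset_of_eval_systemCoeff {n : ℕ} {A : Fin n → Finset ℕ}
    {U : Set (Π i : Fin n, ↥(degSpace n (A i)))} {q : MvPolynomial (SystemIndex n A) ℂ}
    (hq : q ≠ 0) (hU : ∀ f, f ∉ U → eval (systemCoeff A fun i => f i) q = 0) :
    IsGenericSubset U := by
  obtain ⟨N, ⟨e⟩⟩ := Finite.exists_equiv_fin (SystemIndex n A)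
  refine ⟨N, (systemEquiv A).trans (LinearEquiv.funCongrLeft ℂ ℂ e.symm), rename e q,
    fun h => hq (rename_injective e e.injective (by rw [h, map_zero])), fun f hf => ?_⟩
  rw [eval_rename, ← hU f hf]
  congr 2
  funext p
  exact congrArg (systemCoeff A fun i => f i) (e.symm_apply_apply p)

/-- Bernstein–Kushnirenko for `ℂⁿ \ {0}` as a horospherical `GL(n,ℂ)`-space:
for finite sets `A₁, …, A_n ⊆ ℤ_{≥0}` and generic `f_i ∈ L_{A_i}`, the number of solutions in
`ℂⁿ \ {0}` of `f₁ = ⋯ = f_n = 0` equals `n!` times the mixed integral of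
`φ(k) = k^{n-1}/(n-1)!` over the intervals `I_i = [min A_i, max A_i]`. -/
theorem bernstein_kushnirenko_punctured_affine_space
    (n : ℕ) (hn : 0 < n) (A : Fin n → Finset ℕ) (hA : ∀ i, (A i).Nonempty) :
    ∃ U : Set (Π i : Fin n, ↥(degSpace n (A i))), IsGenericSubset U ∧
      ∀ f ∈ U,
        (Set.ncard {x : Fin n → ℂ | x ≠ 0 ∧
            ∀ i, MvPolynomial.eval x ((f i : MvPolynomial (Fin n) ℂ)) = 0} : ℝ)
          = n.factorial *
            mixedIntegralPhi n (fun i => ((A i).min' (hA i) : ℝ))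
              (fun i => ((A i).max' (hA i) : ℝ)) := by
  obtain ⟨q, hq0, hq⟩ := exists_hypersurface_not_regular hA
  refine ⟨{f | IsRegularSystem (fun i => (A i).min' (hA i)) (fun i => (A i).max' (hA i))
    fun i => (f i : MvPolynomial (Fin n) ℂ)},
    isGenericSubset_of_eval_systemCoeff hq0 fun f hf => ?_, fun f hf => ?_⟩
  · by_contra h
    exact hf (hq _ (fun i m => mem_degSpace.1 (f i).2 m) h)
  · have hab : ∀ i, (A i).min' (hA i) ≤ (A i).max' (hA i) := fun i => (A i).min'_le_max' (hA i)
    have h := IsRegularSystem.ncard_eq_prod_sub_prod hab hf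
    rw [factorial_mul_mixedIntegralPhi, ← Nat.cast_prod, ← Nat.cast_prod,
      ← Nat.cast_sub (Finset.prod_le_prod' fun i _ => hab i), ← h]
    rfl
end
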